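/- arXiv:1703.10244 — 5 statements merged into one kernel-verified Lean document; each statement's English description precedes it below -/
import Mathlib

section
/- There is an absolute constant C > 0 such that: if X = (ℝⁿ, ‖·‖) is an n-dimensional normed space (n ≥ 2) whose unit ball B_X contains the Euclidean unit ball B₂ⁿ and B₂ⁿ is the ellipsoid of maximal volume contained in B_X (i.e., every affine image E = T(B₂ⁿ) + a, T invertible linear, with E ⊆ B_X satisfies |E| ≤ |B₂ⁿ|), then β(X) ≤ C/log n. -/
open MeasureTheory ProbabilityTheory Real Set

/-- The standard Gaussian probability measure `γ_n` on `ℝⁿ`. -/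
noncomputable def stdGaussian (n : ℕ) : Measure (EuclideanSpace ℝ (Fin n)) :=
  (Measure.pi fun _ : Fin n => gaussianReal 0 1).map (EuclideanSpace.equiv (Fin n) ℝ).symm

/-- The normalized variance `β(X) = Var‖Z‖ / (E‖Z‖)²` of a norm `N` on `ℝⁿ`, `Z ~ γ_n`. -/
noncomputable def gaussBeta {n : ℕ} (N : EuclideanSpace ℝ (Fin n) → ℝ) : ℝ :=
  variance N (stdGaussian n) / (∫ x, N x ∂stdGaussian n) ^ 2

/-- A seminorm (as a bare function) dominated by the Euclidean norm. -/
structure DomNorm {E : Type*} [NormedAddCommGroup E] [InnerProductSpace ℝ E] (N : E → ℝ) :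
    Prop where
  homog : ∀ (a : ℝ) (x), N (a • x) = |a| * N x
  tri : ∀ x y, N (x + y) ≤ N x + N y
  le_norm : ∀ x, N x ≤ ‖x‖

namespace DomNorm

variable {E : Type*} [NormedAddCommGroup E] [InnerProductSpace ℝ E] {N : E → ℝ}

lemma zero (h : DomNorm N) : N 0 = 0 := by
  have := h.homog 0 0
  simpa using this

lemma neg (h : DomNorm N) (x : E) : N (-x) = N x := by
  have := h.homog (-1) x
  simpa using this

lemma nonneg (h : DomNorm N) (x : E) : 0 ≤ N x := by
  have h1 := h.tri x (-x)
  rw [add_neg_cancel, h.zero, h.neg] at h1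
  linarith

lemma sub_le (h : DomNorm N) (x y : E) : N x - N y ≤ ‖x - y‖ := by
  have h1 := h.tri (x - y) y
  rw [sub_add_cancel] at h1
  linarith [h.le_norm (x - y)]

lemma continuous (h : DomNorm N) : Continuous N := by
  have : LipschitzWith 1 N := by
    apply LipschitzWith.of_dist_le_mul
    intro x y
    rw [Real.dist_eq, dist_eq_norm, abs_le]
    have h1 := h.sub_le x y
    have h2 := h.sub_le y x
    rw [norm_sub_rev] at h2
    simp
    constructor <;> linarith
  exact this.continuous

/-- Norming functional at a point. -/
lemma exists_subgrad (h : DomNorm N) (z : E) :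
    ∃ L : StrongDual ℝ E, ‖L‖ ≤ 1 ∧ L z = N z ∧ ∀ y, L y ≤ N y := by
  have key : ∃ g : E →ₗ[ℝ] ℝ, g z = N z ∧ ∀ y, g y ≤ N y := by
    by_cases hz : z = 0
    · exact ⟨0, by simp [hz, h.zero], fun y => by simpa using h.nonneg y⟩
    · obtain ⟨g, hg1, hg2⟩ := exists_extension_of_le_sublinear
        (LinearPMap.mkSpanSingleton (K := ℝ) (σ := RingHom.id ℝ) z (N z) hz) N
        (fun c hc x => by rw [h.homog, abs_of_pos hc]) h.tri (by
          rintro ⟨x, hx⟩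
          obtain ⟨c, rfl⟩ := Submodule.mem_span_singleton.1 hx
          have := LinearPMap.mkSpanSingleton'_apply (σ := RingHom.id ℝ) z (N z)
            (fun c hc => by
              rcases smul_eq_zero.1 hc with h0 | h0
              · simp [h0]
              · exact absurd h0 hz) c hx
          refine le_trans (le_of_eq this) ?_
          rw [h.homog]
          simp only [RingHom.id_apply, smul_eq_mul]
          exact mul_le_mul_of_nonneg_right (le_abs_self c) (h.nonneg z))
      refine ⟨g, ?_, hg2⟩
      have h1 := hg1 ⟨z, Submodule.mem_span_singleton_self z⟩
      rw [h1]
      exact LinearPMap.mkSpanSingleton_apply ℝ ℝ hz (N z)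
  obtain ⟨g, hg1, hg2⟩ := key
  have hb : ∀ x, ‖g x‖ ≤ 1 * ‖x‖ := by
    intro x
    rw [Real.norm_eq_abs, abs_le]
    have h1 := hg2 x
    have h2 := hg2 (-x)
    rw [map_neg, h.neg] at h2
    have h3 := h.le_norm x
    constructor <;> linarith
  exact ⟨g.mkContinuous 1 hb, LinearMap.mkContinuous_norm_le _ zero_le_one _, hg1, hg2⟩

variable [FiniteDimensional ℝ E] [MeasurableSpace E] [BorelSpace E]

lemma memLp (h : DomNorm N) : MemLp N 2 (ProbabilityTheory.stdGaussian E) := by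
  refine MemLp.of_le (g := (id : E → E)) IsGaussian.memLp_two_id
    h.continuous.aestronglyMeasurable (Filter.Eventually.of_forall fun x => ?_)
  rw [Real.norm_eq_abs, abs_of_nonneg (h.nonneg x)]
  exact h.le_norm x

end DomNorm

section poincare

variable {E : Type*} [NormedAddCommGroup E] [InnerProductSpace ℝ E] [FiniteDimensional ℝ E]
  [MeasurableSpace E] [BorelSpace E]


lemma lintegral_affine_sq (L : StrongDual ℝ E) (a s : ℝ) :
    ∫⁻ w, ENNReal.ofReal ((a - s * L w) ^ 2) ∂(ProbabilityTheory.stdGaussian E)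
      = ENNReal.ofReal (a ^ 2 + s ^ 2 * ‖L‖ ^ 2) := by
  have hL : MemLp L 2 (ProbabilityTheory.stdGaussian E) :=
    IsGaussian.memLp_dual _ L 2 (by norm_num)
  have hX : MemLp (fun w => a - s * L w) 2 (ProbabilityTheory.stdGaussian E) :=
    (memLp_const a).sub (hL.const_mul s)
  rw [← ofReal_integral_eq_lintegral_ofReal hX.integrable_sq
    (Filter.Eventually.of_forall fun _ => sq_nonneg _)]
  congr 1
  have h1 := variance_eq_sub hX
  have h2 : Var[fun w => a - s * L w; ProbabilityTheory.stdGaussian E] = s ^ 2 * ‖L‖ ^ 2 := by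
    rw [variance_const_sub (hL.const_mul s).aestronglyMeasurable, variance_const_mul,
      variance_dual_stdGaussian]
  have h3 : ∫ w, (a - s * L w) ∂(ProbabilityTheory.stdGaussian E) = a := by
    rw [integral_sub (integrable_const _) ((hL.const_mul s).integrable (by norm_num)),
      integral_const_mul, integral_strongDual_stdGaussian]
    simp
  rw [h2, h3] at h1
  simp only [Pi.pow_apply] at h1
  linarith

lemma lintegral_norm_sq :
    ∫⁻ w : E, ENNReal.ofReal (‖w‖ ^ 2) ∂(ProbabilityTheory.stdGaussian E)
      = ENNReal.ofReal (Module.finrank ℝ E) := by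
  have h1 : ∀ w : E, ENNReal.ofReal (‖w‖ ^ 2) = ∑ i, ENNReal.ofReal
      ((0 - 1 * (innerSL ℝ (stdOrthonormalBasis ℝ E i)) w) ^ 2) := by
    intro w
    rw [← ENNReal.ofReal_sum_of_nonneg (fun _ _ => sq_nonneg _),
      ← (stdOrthonormalBasis ℝ E).sum_sq_norm_inner_right w]
    simp
  simp_rw [h1]
  rw [lintegral_finsetSum _ (fun i _ => by fun_prop)]
  simp_rw [lintegral_affine_sq]
  simp

/-- One-sided increment bound. -/
lemma one_sided {N : E → ℝ} (h : DomNorm N) (δ : ℝ) :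
    ∫⁻ p : E × E, ENNReal.ofReal ((max 0 (N p.1 - N (cos δ • p.1 + sin δ • p.2))) ^ 2)
        ∂((ProbabilityTheory.stdGaussian E).prod (ProbabilityTheory.stdGaussian E))
      ≤ ENNReal.ofReal ((1 - cos δ) ^ 2 * Module.finrank ℝ E + sin δ ^ 2) := by
  have hN := h.continuous
  rw [lintegral_prod _ (by fun_prop)]
  calc _ ≤ ∫⁻ z : E, ENNReal.ofReal ((1 - cos δ) ^ 2 * ‖z‖ ^ 2 + sin δ ^ 2)
        ∂(ProbabilityTheory.stdGaussian E) := by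
        refine lintegral_mono fun z => ?_
        obtain ⟨L, hL1, hL2, hL3⟩ := h.exists_subgrad z
        calc _ ≤ ∫⁻ w, ENNReal.ofReal (((1 - cos δ) * N z - sin δ * L w) ^ 2)
              ∂(ProbabilityTheory.stdGaussian E) := by
              refine lintegral_mono fun w => ENNReal.ofReal_le_ofReal ?_
              have h1 := hL3 (cos δ • z + sin δ • w)
              simp only [map_add, map_smul, hL2, smul_eq_mul] at h1
              have h2 : N z - N (cos δ • z + sin δ • w) ≤ (1 - cos δ) * N z - sin δ * L w := by
                linarith
              rcases le_total (N z - N (cos δ • z + sin δ • w)) 0 with h3 | h3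
              · rw [max_eq_left h3]
                simpa using sq_nonneg ((1 - cos δ) * N z - sin δ * L w)
              · rw [max_eq_right h3]
                exact pow_le_pow_left₀ h3 h2 2
          _ = ENNReal.ofReal (((1 - cos δ) * N z) ^ 2 + sin δ ^ 2 * ‖L‖ ^ 2) :=
              lintegral_affine_sq _ _ _
          _ ≤ _ := by
              apply ENNReal.ofReal_le_ofReal
              rw [mul_pow]
              have a1 : N z ^ 2 ≤ ‖z‖ ^ 2 := pow_le_pow_left₀ (h.nonneg z) (h.le_norm z) 2
              have a2 : ‖L‖ ^ 2 ≤ 1 := pow_le_one₀ (norm_nonneg _) hL1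
              nlinarith [sq_nonneg (1 - cos δ), sq_nonneg (sin δ)]
    _ = _ := by
        simp_rw [fun z : E => ENNReal.ofReal_add (mul_nonneg (sq_nonneg (1 - cos δ))
          (sq_nonneg ‖z‖)) (sq_nonneg (sin δ)),
          fun z : E => ENNReal.ofReal_mul (q := ‖z‖ ^ 2) (sq_nonneg (1 - cos δ))]
        rw [lintegral_add_right _ (by fun_prop), lintegral_const_mul _ (by fun_prop),
          lintegral_norm_sq, ENNReal.ofReal_add (by positivity) (by positivity),
          ENNReal.ofReal_mul (sq_nonneg _)]
        simp

lemma mp_rotation (θ : ℝ) : MeasurePreserving (ContinuousLinearMap.rotation (E := E) θ)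
    ((ProbabilityTheory.stdGaussian E).prod (ProbabilityTheory.stdGaussian E))
    ((ProbabilityTheory.stdGaussian E).prod (ProbabilityTheory.stdGaussian E)) :=
  ⟨by fun_prop, IsGaussian.map_rotation_eq_self (by simp) θ⟩

/-- The `L²` size of the increment of `N` along the rotation by `θ`. -/
noncomputable def incr (N : E → ℝ) (θ : ℝ) : ENNReal :=
  eLpNorm (fun p : E × E => N p.1 - N (cos θ • p.1 + sin θ • p.2)) 2
    ((ProbabilityTheory.stdGaussian E).prod (ProbabilityTheory.stdGaussian E))

lemma incr_add {N : E → ℝ} (h : DomNorm N) (α β : ℝ) :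
    incr N (α + β) ≤ incr N α + incr N β := by
  have hN := h.continuous
  have h1 : incr N β = eLpNorm ((fun p : E × E => N p.1 - N (cos β • p.1 + sin β • p.2)) ∘
      ContinuousLinearMap.rotation (E := E) α) 2
    ((ProbabilityTheory.stdGaussian E).prod (ProbabilityTheory.stdGaussian E)) := by
    rw [eLpNorm_comp_measurePreserving (by fun_prop) (mp_rotation α)]
    rfl
  rw [h1]
  unfold incr
  refine le_trans (le_of_eq ?_) (eLpNorm_add_le ?_ ?_ (by norm_num))
  · congr 1
    ext p
    simp only [Pi.add_apply, Function.comp_apply, ContinuousLinearMap.rotation_apply]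
    rw [show cos (α + β) • p.1 + sin (α + β) • p.2 = cos β • (cos α • p.1 + sin α • p.2) +
        sin β • (-sin α • p.1 + cos α • p.2) by
      rw [cos_add, sin_add]; module]
    ring
  · exact Continuous.aestronglyMeasurable (by fun_prop)
  · exact Continuous.aestronglyMeasurable (by fun_prop)

lemma incr_nsmul {N : E → ℝ} (h : DomNorm N) (δ : ℝ) (k : ℕ) :
    incr N (k * δ) ≤ k * incr N δ := by
  induction k with
  | zero => simp [incr]
  | succ k ih =>
    push_cast
    rw [add_mul, one_mul, add_mul, one_mul]
    exact (incr_add h _ _).trans (add_le_add_left ih _)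

lemma incr_sq {N : E → ℝ} (h : DomNorm N) (δ : ℝ) :
    incr N δ ^ 2 ≤ ENNReal.ofReal (2 * ((1 - cos δ) ^ 2 * Module.finrank ℝ E + sin δ ^ 2)) := by
  have hN := h.continuous
  have h0 : incr N δ ^ 2 = ∫⁻ p : E × E, ENNReal.ofReal
      ((N p.1 - N (cos δ • p.1 + sin δ • p.2)) ^ 2)
      ∂((ProbabilityTheory.stdGaussian E).prod (ProbabilityTheory.stdGaussian E)) := by
    have := eLpNorm_nnreal_pow_eq_lintegral
      (μ := (ProbabilityTheory.stdGaussian E).prod (ProbabilityTheory.stdGaussian E))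
      (f := fun p : E × E => N p.1 - N (cos δ • p.1 + sin δ • p.2)) (p := 2) (by norm_num)
    have e : ((2 : NNReal) : ℝ) = (2 : ℕ) := by norm_num
    rw [e] at this
    simp only [ENNReal.rpow_natCast] at this
    refine Eq.trans this (lintegral_congr fun p => ?_)
    rw [← ofReal_norm, ← ENNReal.ofReal_pow (norm_nonneg _), Real.norm_eq_abs, sq_abs]
  have hneg : ∫⁻ p : E × E, ENNReal.ofReal
      ((max 0 (N (cos δ • p.1 + sin δ • p.2) - N p.1)) ^ 2)
      ∂((ProbabilityTheory.stdGaussian E).prod (ProbabilityTheory.stdGaussian E)) ≤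
      ENNReal.ofReal ((1 - cos δ) ^ 2 * Module.finrank ℝ E + sin δ ^ 2) := by
    have h1 := one_sided h (-δ)
    rw [← (mp_rotation δ).lintegral_comp (by fun_prop)] at h1
    rw [cos_neg, sin_neg, neg_sq] at h1
    refine le_trans (le_of_eq (lintegral_congr fun p => ?_)) h1
    simp only [ContinuousLinearMap.rotation_apply]
    congr 5
    rw [show cos δ • (cos δ • p.1 + sin δ • p.2) + -sin δ • (-sin δ • p.1 + cos δ • p.2)
      = (cos δ ^ 2 + sin δ ^ 2) • p.1 by module, cos_sq_add_sin_sq, one_smul]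
  rw [h0, two_mul, ENNReal.ofReal_add (by positivity) (by positivity)]
  refine le_trans ?_ (add_le_add (one_sided h δ) hneg)
  rw [← lintegral_add_left (by fun_prop)]
  refine lintegral_mono fun p => ?_
  rw [← ENNReal.ofReal_add (by positivity) (by positivity)]
  apply ENNReal.ofReal_le_ofReal
  set u := N p.1
  set v := N (cos δ • p.1 + sin δ • p.2)
  rcases le_total u v with huv | huv
  · rw [max_eq_right (by linarith : 0 ≤ v - u)]
    nlinarith [sq_nonneg (max 0 (u - v))]
  · rw [max_eq_right (by linarith : 0 ≤ u - v)]
    nlinarith [sq_nonneg (max 0 (v - u))]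

lemma variance_le {N : E → ℝ} (h : DomNorm N) (hn : 1 ≤ Module.finrank ℝ E) :
    Var[N; ProbabilityTheory.stdGaussian E] ≤ 10 := by
  have hN := h.continuous
  set n := Module.finrank ℝ E with hndef
  have hn' : (1 : ℝ) ≤ n := by exact_mod_cast hn
  set δ : ℝ := π / (2 * n) with hδ
  have h1 := incr_nsmul h δ n
  rw [show (n : ℝ) * δ = π / 2 by rw [hδ]; field_simp] at h1
  have h2 : incr N (π / 2) ^ 2 ≤ ENNReal.ofReal 10 := by
    calc _ ≤ ((n : ENNReal) * incr N δ) ^ 2 := by gcongr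
      _ = (n : ENNReal) ^ 2 * incr N δ ^ 2 := by ring
      _ ≤ (n : ENNReal) ^ 2 * ENNReal.ofReal (2 * ((1 - cos δ) ^ 2 * n + sin δ ^ 2)) := by
        gcongr
        exact incr_sq h δ
      _ = ENNReal.ofReal ((n : ℝ) ^ 2 * (2 * ((1 - cos δ) ^ 2 * n + sin δ ^ 2))) := by
        rw [ENNReal.ofReal_mul (p := (n : ℝ) ^ 2) (by positivity), ENNReal.ofReal_pow (by positivity),
          ENNReal.ofReal_natCast]
      _ ≤ _ := by
        apply ENNReal.ofReal_le_ofReal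
        have c1 : 0 ≤ 1 - cos δ := by linarith [cos_le_one δ]
        have c2 : 1 - cos δ ≤ δ ^ 2 / 2 := by linarith [one_sub_sq_div_two_le_cos (x := δ)]
        have c3 : (1 - cos δ) ^ 2 ≤ (δ ^ 2 / 2) ^ 2 := pow_le_pow_left₀ c1 c2 2
        have c4 : sin δ ^ 2 ≤ δ ^ 2 := by
          rw [← sq_abs, ← sq_abs δ]
          exact pow_le_pow_left₀ (abs_nonneg _) (abs_sin_le_abs) 2
        have hd : (n : ℝ) * δ = π / 2 := by rw [hδ]; field_simp
        have hpi : π ^ 2 ≤ 10 := by nlinarith [pi_lt_d2, pi_pos]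
        have e : (n : ℝ) ^ 2 * (2 * ((δ ^ 2 / 2) ^ 2 * n + δ ^ 2)) ≤ 10 := by
          have e2 : (n * δ) ^ 2 ≤ 10 / 4 := by rw [hd]; nlinarith
          have e3 : (n : ℝ) * δ ^ 2 ≤ 10 / 4 := by
            nlinarith [sq_nonneg δ, mul_nonneg (mul_nonneg (by linarith : (0:ℝ) ≤ n) (by linarith : (0:ℝ) ≤ n - 1)) (sq_nonneg δ)]
          have e4 : (n : ℝ) ^ 2 * (2 * ((δ ^ 2 / 2) ^ 2 * n + δ ^ 2)) =
            (n * δ) ^ 2 * (n * δ ^ 2) / 2 + 2 * (n * δ) ^ 2 := by ring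
          rw [e4]
          have : (n * δ) ^ 2 * (n * δ ^ 2) ≤ 10 / 4 * (10 / 4) :=
            mul_le_mul e2 e3 (by positivity) (by norm_num)
          linarith
        refine le_trans ?_ e
        gcongr
  have h3 := variance_add_prod (μ := ProbabilityTheory.stdGaussian E)
    (ν := ProbabilityTheory.stdGaussian E) h.memLp h.memLp.neg
  rw [variance_neg] at h3
  have h4 : Var[fun p : E × E => N p.1 + (-N) p.2;
      (ProbabilityTheory.stdGaussian E).prod (ProbabilityTheory.stdGaussian E)] ≤ 10 := by
    have hm : AEStronglyMeasurable (fun p : E × E => N p.1 + (-N) p.2)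
      ((ProbabilityTheory.stdGaussian E).prod (ProbabilityTheory.stdGaussian E)) :=
      Continuous.aestronglyMeasurable (by simp only [Pi.neg_apply]; fun_prop)
    refine (variance_le_expectation_sq hm).trans ?_
    have h5 : incr N (π / 2) ^ 2 = ∫⁻ p : E × E, ENNReal.ofReal
      ((N p.1 + (-N) p.2) ^ 2)
      ∂((ProbabilityTheory.stdGaussian E).prod (ProbabilityTheory.stdGaussian E)) := by
      have := eLpNorm_nnreal_pow_eq_lintegral
        (μ := (ProbabilityTheory.stdGaussian E).prod (ProbabilityTheory.stdGaussian E))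
        (f := fun p : E × E => N p.1 - N (cos (π / 2) • p.1 + sin (π / 2) • p.2)) (p := 2)
        (by norm_num)
      have e : ((2 : NNReal) : ℝ) = (2 : ℕ) := by norm_num
      rw [e] at this
      simp only [ENNReal.rpow_natCast] at this
      refine Eq.trans this (lintegral_congr fun p => ?_)
      rw [← ofReal_norm, ← ENNReal.ofReal_pow (norm_nonneg _), Real.norm_eq_abs, sq_abs]
      simp [sub_eq_add_neg]
    rw [h5] at h2
    simp only [Pi.pow_apply]
    rw [integral_eq_lintegral_of_nonneg_ae (Filter.Eventually.of_forall fun _ => sq_nonneg _)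
      (hm.pow 2)]
    exact ENNReal.toReal_le_of_le_ofReal (by norm_num) h2
  rw [h3] at h4
  have := variance_nonneg N (ProbabilityTheory.stdGaussian E)
  linarith

end poincare

section dvoretzkyRogers

variable {n : ℕ}

lemma exists_big {N : EuclideanSpace ℝ (Fin n) → ℝ} (h : DomNorm N) (hn : 1 ≤ n)
    (hJ : ∀ (T : EuclideanSpace ℝ (Fin n) ≃ₗ[ℝ] EuclideanSpace ℝ (Fin n))
            (a : EuclideanSpace ℝ (Fin n)),
          (∀ x ∈ Metric.closedBall (0 : EuclideanSpace ℝ (Fin n)) 1, N (T x + a) ≤ 1) →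
          volume ((fun x => T x + a) '' Metric.closedBall (0 : EuclideanSpace ℝ (Fin n)) 1)
            ≤ volume (Metric.closedBall (0 : EuclideanSpace ℝ (Fin n)) 1))
    (b : OrthonormalBasis (Fin n) ℝ (EuclideanSpace ℝ (Fin n))) (k : ℕ) (hk : 2 * k ≤ n) :
    ∃ x : EuclideanSpace ℝ (Fin n), ‖x‖ = 1 ∧ (∀ i : Fin n, (i : ℕ) < k → inner ℝ (b i) x = 0) ∧
      1 / 4 ≤ N x := by
  by_contra! hc
  have hq : ∀ x : EuclideanSpace ℝ (Fin n), (∀ i : Fin n, (i : ℕ) < k → inner ℝ (b i) x = 0) →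
      N x ≤ 1 / 4 * ‖x‖ := by
    intro x hx
    by_cases hx0 : x = 0
    · simp [hx0, h.zero]
    · have hpos : 0 < ‖x‖ := norm_pos_iff.2 hx0
      have h1 := hc (‖x‖⁻¹ • x) (by rw [norm_smul, norm_inv, norm_norm]; field_simp)
        (fun i hi => by rw [inner_smul_right, hx i hi, mul_zero])
      rw [h.homog, abs_of_pos (inv_pos.2 hpos), inv_mul_lt_iff₀ hpos] at h1
      linarith
  set d : Fin n → ℝ := fun i => if (i : ℕ) < k then 1 / 2 else 3 with hd
  set T₀ := Matrix.toLin b.toBasis b.toBasis (Matrix.diagonal d) with hT₀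
  have hdet : LinearMap.det T₀ = (1 / 2 : ℝ) ^ k * 3 ^ (n - k) := by
    rw [hT₀, LinearMap.det_toLin, Matrix.det_diagonal]
    have e1 : ∏ i : Fin n, d i = ∏ i ∈ Finset.range n, if i < k then (1 / 2 : ℝ) else 3 :=
      Fin.prod_univ_eq_prod_range (fun i => if i < k then (1 / 2 : ℝ) else 3) n
    rw [e1, Finset.prod_ite, Finset.prod_const, Finset.prod_const]
    have e2 : (Finset.range n).filter (fun i => i < k) = Finset.range k := by
      ext i; simp; omega
    have e3 : (Finset.range n).filter (fun i => ¬ i < k) = Finset.Ico k n := by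
      ext i; simp; omega
    rw [e2, e3]
    simp
  have hdet1 : 1 < LinearMap.det T₀ := by
    rw [hdet]
    have h1 : (2 : ℝ) ^ k ≤ 2 ^ (n - k) := pow_le_pow_right₀ (by norm_num) (by omega)
    have h2 : (2 : ℝ) ^ (n - k) < 3 ^ (n - k) :=
      pow_lt_pow_left₀ (by norm_num) (by norm_num) (by omega)
    rw [one_div, inv_pow, ← div_eq_inv_mul, one_lt_div (by positivity)]
    linarith
  have hTx : ∀ x, T₀ x = ∑ i, (d i * inner ℝ (b i) x) • b i := by
    intro x
    rw [hT₀, Matrix.toLin_apply]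
    simp [Matrix.mulVec_diagonal, b.repr_apply_apply]
  set T := T₀.equivOfDetNeZero (by linarith) with hT
  have hTT : ∀ x, T x = T₀ x := fun x => rfl
  have hball : ∀ x ∈ Metric.closedBall (0 : EuclideanSpace ℝ (Fin n)) 1, N (T x + 0) ≤ 1 := by
    intro x hx
    rw [mem_closedBall_zero_iff] at hx
    rw [add_zero, hTT, hTx]
    set P : EuclideanSpace ℝ (Fin n) := ∑ i : Fin n,
      (if (i : ℕ) < k then inner ℝ (b i) x else 0) • b i with hP
    set Q : EuclideanSpace ℝ (Fin n) := ∑ i : Fin n,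
      (if (i : ℕ) < k then 0 else inner ℝ (b i) x) • b i with hQ
    have e1 : ∑ i, (d i * inner ℝ (b i) x) • b i = (1 / 2 : ℝ) • P + (3 : ℝ) • Q := by
      rw [hP, hQ, Finset.smul_sum, Finset.smul_sum, ← Finset.sum_add_distrib]
      refine Finset.sum_congr rfl fun i _ => ?_
      by_cases hi : (i : ℕ) < k <;> simp [hd, hi, smul_smul]
    have hPi : ∀ i, inner ℝ (b i) P = if (i : ℕ) < k then inner ℝ (b i) x else 0 := by
      intro i
      rw [hP, b.orthonormal.inner_right_fintype]
    have hQi : ∀ i, inner ℝ (b i) Q = if (i : ℕ) < k then 0 else inner ℝ (b i) x := by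
      intro i
      rw [hQ, b.orthonormal.inner_right_fintype]
    have e2 : ‖P‖ ^ 2 + ‖Q‖ ^ 2 = ‖x‖ ^ 2 := by
      rw [← b.sum_sq_norm_inner_right P, ← b.sum_sq_norm_inner_right Q,
        ← b.sum_sq_norm_inner_right x, ← Finset.sum_add_distrib]
      refine Finset.sum_congr rfl fun i _ => ?_
      rw [hPi, hQi]
      by_cases hi : (i : ℕ) < k <;> simp [hi]
    rw [e1]
    have t1 := h.tri ((1 / 2 : ℝ) • P) ((3 : ℝ) • Q)
    rw [h.homog, h.homog, abs_of_pos (by norm_num), abs_of_pos (by norm_num)] at t1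
    have t2 := h.le_norm P
    have t3 := hq Q (fun i hi => by rw [hQi, if_pos hi])
    have t4 : ‖x‖ ^ 2 ≤ 1 := pow_le_one₀ (norm_nonneg _) hx
    have t5 : 1 / 2 * ‖P‖ + 3 / 4 * ‖Q‖ ≤ 1 := by
      apply le_of_pow_le_pow_left₀ two_ne_zero zero_le_one
      nlinarith [sq_nonneg (3 / 4 * ‖P‖ - 1 / 2 * ‖Q‖)]
    linarith
  have hv := hJ T 0 hball
  simp only [add_zero] at hv
  have hv2 : volume ((fun x => T x) '' Metric.closedBall (0 : EuclideanSpace ℝ (Fin n)) 1) =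
      ENNReal.ofReal |LinearMap.det T₀| *
        volume (Metric.closedBall (0 : EuclideanSpace ℝ (Fin n)) 1) :=
    Measure.addHaar_image_linearMap volume T₀ _
  rw [hv2] at hv
  have p1 : volume (Metric.closedBall (0 : EuclideanSpace ℝ (Fin n)) 1) ≠ 0 :=
    (Metric.measure_closedBall_pos volume _ one_pos).ne'
  have p2 : volume (Metric.closedBall (0 : EuclideanSpace ℝ (Fin n)) 1) ≠ ⊤ :=
    measure_closedBall_lt_top.ne
  have hv3 : ENNReal.ofReal |LinearMap.det T₀| ≤ 1 := by
    by_contra! hcon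
    have := ENNReal.mul_lt_mul_left p1 p2 hcon
    rw [one_mul] at this
    exact absurd hv (not_le.2 this)
  rw [ENNReal.ofReal_le_one] at hv3
  exact absurd (le_abs_self _) (not_le.2 (lt_of_le_of_lt hv3 hdet1))

lemma exists_basis {N : EuclideanSpace ℝ (Fin n) → ℝ} (h : DomNorm N) (hn : 1 ≤ n)
    (hJ : ∀ (T : EuclideanSpace ℝ (Fin n) ≃ₗ[ℝ] EuclideanSpace ℝ (Fin n))
            (a : EuclideanSpace ℝ (Fin n)),
          (∀ x ∈ Metric.closedBall (0 : EuclideanSpace ℝ (Fin n)) 1, N (T x + a) ≤ 1) →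
          volume ((fun x => T x + a) '' Metric.closedBall (0 : EuclideanSpace ℝ (Fin n)) 1)
            ≤ volume (Metric.closedBall (0 : EuclideanSpace ℝ (Fin n)) 1))
    (k : ℕ) (hk : k ≤ n / 2 + 1) :
    ∃ b : OrthonormalBasis (Fin n) ℝ (EuclideanSpace ℝ (Fin n)),
      ∀ i : Fin n, (i : ℕ) < k → 1 / 4 ≤ N (b i) := by
  induction k with
  | zero => exact ⟨EuclideanSpace.basisFun (Fin n) ℝ, fun i hi => absurd hi (Nat.not_lt_zero _)⟩
  | succ k ih =>
    obtain ⟨b, hb⟩ := ih (by omega)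
    obtain ⟨x, hx1, hx2, hx3⟩ := exists_big h hn hJ b k (by omega)
    have hcard : Module.finrank ℝ (EuclideanSpace ℝ (Fin n)) = Fintype.card (Fin n) := by simp
    obtain ⟨b', hb'⟩ := Orthonormal.exists_orthonormalBasis_extension_of_card_eq hcard
      (v := fun i : Fin n => if (i : ℕ) < k then b i else x)
      (s := {i : Fin n | (i : ℕ) < k + 1}) (by
        constructor
        · rintro ⟨i, hi⟩
          simp only [Set.domRestrict_apply]
          split_ifs
          · exact b.orthonormal.1 i
          · exact hx1
        · rintro ⟨i, hi⟩ ⟨j, hj⟩ hij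
          have hij' : i ≠ j := fun e => hij (by simp [e])
          have hij'' : (i : ℕ) ≠ j := fun e => hij' (Fin.ext e)
          simp only [Set.mem_ofPred_eq] at hi hj
          simp only [Set.domRestrict_apply]
          split_ifs with h1 h2 h2
          · exact b.orthonormal.2 hij'
          · exact hx2 i h1
          · rw [real_inner_comm]; exact hx2 j h2
          · omega)
    refine ⟨b', fun i hi => ?_⟩
    rw [hb' i hi]
    split_ifs with h1
    · exact hb i h1
    · exact hx3

end dvoretzkyRogers

section lower

variable {n : ℕ}

/-- The constant in the Gaussian tail bound. -/
noncomputable def kap : ℝ := (√(2 * π))⁻¹ * rexp (-1)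

lemma kap_pos : 0 < kap := by unfold kap; positivity

lemma kap_le_one : kap ≤ 1 := by
  unfold kap
  have h1 : (1 : ℝ) ≤ √(2 * π) := by
    rw [Real.one_le_sqrt]
    linarith [pi_gt_three]
  have h2 : rexp (-1) ≤ 1 := Real.exp_le_one_iff.2 (by norm_num)
  exact mul_le_one₀ (inv_le_one_of_one_le₀ h1) (Real.exp_pos _).le h2

lemma tail_lower (t : ℝ) (ht : 0 ≤ t) :
    kap * rexp (-t ^ 2) ≤ (gaussianReal 0 1).real (Icc t (t + 1)) := by
  have h1 : ENNReal.ofReal (kap * rexp (-t ^ 2)) ≤ gaussianReal 0 1 (Icc t (t + 1)) := by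
    rw [gaussianReal_apply _ (by norm_num)]
    calc _ = ∫⁻ x in Icc t (t + 1), ENNReal.ofReal (kap * rexp (-t ^ 2)) := by
          rw [setLIntegral_const]
          simp
      _ ≤ _ := by
          refine setLIntegral_mono' measurableSet_Icc fun x hx => ?_
          rw [gaussianPDF]
          apply ENNReal.ofReal_le_ofReal
          rw [gaussianPDFReal, kap, mul_assoc, ← Real.exp_add]
          simp only [NNReal.coe_one, mul_one, sub_zero]
          gcongr
          have : x ^ 2 ≤ (t + 1) ^ 2 := pow_le_pow_left₀ (ht.trans hx.1) hx.2 2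
          nlinarith [sq_nonneg (t - 1)]
  rw [measureReal_def]
  exact (ENNReal.ofReal_le_iff_le_toReal (measure_ne_top _ _)).1 h1

lemma prob_small (b : OrthonormalBasis (Fin n) ℝ (EuclideanSpace ℝ (Fin n))) (m : ℕ) (hm : 1 ≤ m)
    (hmn : m ≤ n) :
    (ProbabilityTheory.stdGaussian (EuclideanSpace ℝ (Fin n))).real
      {z | ∀ i : Fin n, (i : ℕ) < m → |inner ℝ (b i) z| < √(Real.log m)} ≤ rexp (-kap) := by
  set t := √(Real.log m) with ht
  have ht0 : 0 ≤ t := Real.sqrt_nonneg _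
  have hm' : (1 : ℝ) ≤ m := by exact_mod_cast hm
  have ht2 : rexp (-t ^ 2) = 1 / m := by
    rw [ht, Real.sq_sqrt (Real.log_nonneg hm'), Real.exp_neg, Real.exp_log (by linarith), one_div]
  have hp : (gaussianReal 0 1).real (Ioo (-t) t) ≤ 1 - kap / m := by
    have h1 := tail_lower t ht0
    rw [ht2] at h1
    have h2 : (gaussianReal 0 1).real (Ioo (-t) t ∪ Icc t (t + 1)) =
        (gaussianReal 0 1).real (Ioo (-t) t) + (gaussianReal 0 1).real (Icc t (t + 1)) :=
      measureReal_union (Set.disjoint_left.2 fun x hx hx' => absurd hx.2 (not_lt.2 hx'.1))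
        measurableSet_Icc
    have h3 : (gaussianReal 0 1).real (Ioo (-t) t ∪ Icc t (t + 1)) ≤ 1 := measureReal_le_one
    rw [mul_one_div] at h1
    linarith
  have hmeas : Measurable fun x : Fin n → ℝ => ∑ i, x i • b i := by fun_prop
  rw [ProbabilityTheory.stdGaussian_eq_map_pi_orthonormalBasis b,
    map_measureReal_apply hmeas (by
      have : {z : EuclideanSpace ℝ (Fin n) | ∀ i : Fin n, (i : ℕ) < m → |inner ℝ (b i) z| < t} =
        ⋂ i : Fin n, ⋂ _ : (i : ℕ) < m, {z | |inner ℝ (b i) z| < t} := by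
        ext; simp
      rw [this]
      exact MeasurableSet.iInter fun i => MeasurableSet.iInter fun _ =>
        measurableSet_lt (by fun_prop) measurable_const)]
  have hset : (fun x : Fin n → ℝ => ∑ i, x i • b i) ⁻¹'
      {z | ∀ i : Fin n, (i : ℕ) < m → |inner ℝ (b i) z| < t} =
      Set.univ.pi fun i : Fin n => if (i : ℕ) < m then Ioo (-t) t else Set.univ := by
    ext x
    simp only [Set.mem_preimage, Set.mem_ofPred_eq, Set.mem_pi, Set.mem_univ, true_implies,
      b.orthonormal.inner_right_fintype, abs_lt]
    refine forall_congr' fun i => ?_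
    split_ifs with hi <;> simp [hi]
  rw [hset, measureReal_def, Measure.pi_pi, ENNReal.toReal_prod]
  have e1 : ∏ i : Fin n, ((gaussianReal 0 1) (if (i : ℕ) < m then Ioo (-t) t else Set.univ)).toReal
      = ∏ i ∈ Finset.range n, if i < m then (gaussianReal 0 1).real (Ioo (-t) t) else 1 := by
    rw [← Fin.prod_univ_eq_prod_range
      (fun i => if i < m then (gaussianReal 0 1).real (Ioo (-t) t) else 1) n]
    refine Finset.prod_congr rfl fun i _ => ?_
    split_ifs <;> simp [measureReal_def]
  rw [e1, Finset.prod_ite, Finset.prod_const, Finset.prod_const_one, mul_one]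
  have e2 : (Finset.range n).filter (fun i => i < m) = Finset.range m := by
    ext i; simp; omega
  rw [e2, Finset.card_range]
  refine (pow_le_pow_left₀ measureReal_nonneg hp m).trans ?_
  exact one_sub_div_pow_le_exp_neg (kap_le_one.trans hm')

lemma expect_lower {N : EuclideanSpace ℝ (Fin n) → ℝ} (h : DomNorm N)
    (b : OrthonormalBasis (Fin n) ℝ (EuclideanSpace ℝ (Fin n))) (m : ℕ) (hm : 1 ≤ m)
    (hmn : m ≤ n) (hb : ∀ i : Fin n, (i : ℕ) < m → 1 / 4 ≤ N (b i)) :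
    (1 - rexp (-kap)) * (√(Real.log m) / 4) ≤
      ∫ x, N x ∂(ProbabilityTheory.stdGaussian (EuclideanSpace ℝ (Fin n))) := by
  set t := √(Real.log m) with ht
  have ht0 : 0 ≤ t := Real.sqrt_nonneg _
  set μ := ProbabilityTheory.stdGaussian (EuclideanSpace ℝ (Fin n)) with hμ
  have hNint : Integrable N μ := h.memLp.integrable (by norm_num)
  set s : Finset (Fin n) := Finset.univ.filter (fun i => (i : ℕ) < m) with hs
  set A : Fin n → Set (EuclideanSpace ℝ (Fin n)) := fun i =>
    {z | t ≤ |inner ℝ (b i) z| ∧ ∀ j : Fin n, j < i → |inner ℝ (b j) z| < t} with hA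
  have hAm : ∀ i, MeasurableSet (A i) := by
    intro i
    have : A i = {z | t ≤ |inner ℝ (b i) z|} ∩
        ⋂ j : Fin n, ⋂ _ : j < i, {z | |inner ℝ (b j) z| < t} := by
      ext; simp [hA]
    rw [this]
    exact (measurableSet_le measurable_const (by fun_prop)).inter
      (MeasurableSet.iInter fun i => MeasurableSet.iInter fun _ =>
        measurableSet_lt (by fun_prop) measurable_const)
  have hdisj : ∀ i j, i ≠ j → Disjoint (A i) (A j) := by
    have key : ∀ i j, i < j → Disjoint (A i) (A j) := fun i j hij =>
      Set.disjoint_left.2 fun z hz hz' => absurd (hz'.2 i hij) (not_lt.2 hz.1)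
    intro i j hij
    rcases lt_or_gt_of_ne hij with h1 | h1
    · exact key i j h1
    · exact (key j i h1).symm
  have hAi : ∀ i ∈ s, μ.real (A i) * (t / 4) ≤ ∫ x in A i, N x ∂μ := by
    intro i hi
    have him : (i : ℕ) < m := by simpa [hs] using hi
    set R := (Submodule.span ℝ {b i}).reflection with hR
    have hRx : ∀ x, R x = 2 • (inner ℝ (b i) x) • b i - x := by
      intro x
      rw [hR, Submodule.reflection_singleton_apply]
      simp
    have hRp : MeasurePreserving R μ μ := ⟨by fun_prop, ProbabilityTheory.stdGaussian_map R⟩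
    have hRA : R ⁻¹' (A i) = A i := by
      have hin : ∀ j z, |inner ℝ (b j) (R z)| = |inner ℝ (b j) z| := by
        intro j z
        rw [hRx, inner_sub_right, ← Nat.cast_smul_eq_nsmul ℝ, inner_smul_right, inner_smul_right]
        by_cases hji : j = i
        · subst hji
          rw [real_inner_self_eq_norm_sq, b.orthonormal.1]
          congr 1
          push_cast
          ring
        · rw [b.orthonormal.2 hji]
          simp
      ext z
      simp only [hA, Set.mem_preimage, Set.mem_ofPred_eq, hin]
    have hflip : ∫ x in A i, N (R x) ∂μ = ∫ x in A i, N x ∂μ := by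
      have := hRp.setIntegral_preimage_emb R.toHomeomorph.measurableEmbedding N (A i)
      rwa [hRA] at this
    have hRNint : Integrable (fun x => N (R x)) μ := hRp.integrable_comp_of_integrable hNint
    have h1 : μ.real (A i) • (t / 4 * 2) ≤ ∫ x in A i, (N x + N (R x)) ∂μ := by
      refine setIntegral_ge_of_const_le (hAm i) (measure_ne_top _ _) (fun x hx => ?_)
        (hNint.add hRNint).integrableOn
      have h2 := h.tri x (R x)
      have h5 : x + R x = (2 * inner ℝ (b i) x) • b i := by
        rw [hRx, add_sub_cancel, ← Nat.cast_smul_eq_nsmul ℝ, smul_smul]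
        norm_num
      rw [h5, h.homog, abs_mul, abs_two] at h2
      have h3 := hx.1
      have h4 := hb i him
      have : t * (1 / 4) ≤ |inner ℝ (b i) x| * N (b i) :=
        mul_le_mul h3 h4 (by norm_num) (abs_nonneg _)
      linarith
    rw [integral_add hNint.integrableOn hRNint.integrableOn, hflip, smul_eq_mul] at h1
    linarith
  have hsum : ∫ x in ⋃ i ∈ s, A i, N x ∂μ = ∑ i ∈ s, ∫ x in A i, N x ∂μ :=
    integral_biUnion_finset s (fun i _ => hAm i) (fun i _ j _ hij => hdisj i j hij)
      (fun i _ => hNint.integrableOn)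
  have hmsum : μ.real (⋃ i ∈ s, A i) = ∑ i ∈ s, μ.real (A i) :=
    measureReal_biUnion_finset (fun i _ j _ hij => hdisj i j hij) (fun i _ => hAm i)
  have hprob : 1 - rexp (-kap) ≤ μ.real (⋃ i ∈ s, A i) := by
    have h1 := prob_small b m hm hmn
    have hsub : (⋃ i ∈ s, A i)ᶜ ⊆
        {z | ∀ i : Fin n, (i : ℕ) < m → |inner ℝ (b i) z| < √(Real.log m)} := by
      intro z hz
      simp only [Set.mem_compl_iff, Set.mem_iUnion, not_exists, hs, Finset.mem_filter,
        Finset.mem_univ, true_and] at hz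
      intro i
      induction i using WellFoundedLT.induction with
      | ind i ih =>
        intro him
        by_contra! hlt
        exact hz i him ⟨hlt, fun j hj => ih j hj (lt_trans hj him)⟩
    have h2 : μ.real (⋃ i ∈ s, A i)ᶜ ≤ rexp (-kap) := (measureReal_mono hsub).trans h1
    rw [probReal_compl_eq_one_sub (Finset.measurableSet_biUnion _ fun i _ => hAm i)] at h2
    linarith
  calc _ ≤ μ.real (⋃ i ∈ s, A i) * (t / 4) := by gcongr
    _ = ∑ i ∈ s, μ.real (A i) * (t / 4) := by rw [hmsum, Finset.sum_mul]
    _ ≤ ∑ i ∈ s, ∫ x in A i, N x ∂μ := Finset.sum_le_sum hAi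
    _ = ∫ x in ⋃ i ∈ s, A i, N x ∂μ := hsum.symm
    _ ≤ _ := setIntegral_le_integral hNint (Filter.Eventually.of_forall fun x => h.nonneg x)

end lower

lemma stdGaussian_eq (n : ℕ) :
    _root_.stdGaussian n = ProbabilityTheory.stdGaussian (EuclideanSpace ℝ (Fin n)) := by
  rw [← ProbabilityTheory.map_pi_eq_stdGaussian]
  rfl

/-- If the unit ball of `X = (ℝⁿ, ‖·‖)` (with `n ≥ 2`) contains the
Euclidean unit ball `B₂ⁿ` and `B₂ⁿ` is the ellipsoid of maximal volume inside `B_X`,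
then `β(X) ≤ C / log n` for an absolute constant `C > 0`. -/
theorem beta_le_of_john_position :
    ∃ C : ℝ, 0 < C ∧
      ∀ (n : ℕ), 2 ≤ n →
      ∀ N : EuclideanSpace ℝ (Fin n) → ℝ,
        (∀ x, x ≠ 0 → 0 < N x) →
        (∀ (a : ℝ) (x), N (a • x) = |a| * N x) →
        (∀ x y, N (x + y) ≤ N x + N y) →
        (∀ x : EuclideanSpace ℝ (Fin n), ‖x‖ ≤ 1 → N x ≤ 1) →
        (∀ (T : EuclideanSpace ℝ (Fin n) ≃ₗ[ℝ] EuclideanSpace ℝ (Fin n))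
            (a : EuclideanSpace ℝ (Fin n)),
          (∀ x ∈ Metric.closedBall (0 : EuclideanSpace ℝ (Fin n)) 1, N (T x + a) ≤ 1) →
          volume ((fun x => T x + a) '' Metric.closedBall (0 : EuclideanSpace ℝ (Fin n)) 1)
            ≤ volume (Metric.closedBall (0 : EuclideanSpace ℝ (Fin n)) 1)) →
        gaussBeta N ≤ C / Real.log n := by
  have hk : 0 < 1 - rexp (-kap) := by
    have : rexp (-kap) < 1 := by
      rw [Real.exp_lt_one_iff]
      linarith [kap_pos]
    linarith
  refine ⟨320 / (1 - rexp (-kap)) ^ 2, by positivity, ?_⟩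
  intro n hn N _ hhom htri hball hJ
  have hD : DomNorm N := by
    refine ⟨hhom, htri, fun x => ?_⟩
    by_cases hx : x = 0
    · have := hhom 0 0
      simp only [smul_zero, abs_zero, zero_mul] at this
      simp [hx, this]
    · have hpos : 0 < ‖x‖ := norm_pos_iff.2 hx
      have h1 := hball (‖x‖⁻¹ • x) (by rw [norm_smul, norm_inv, norm_norm]; field_simp; rfl)
      rw [hhom, abs_of_pos (inv_pos.2 hpos), inv_mul_le_iff₀ hpos] at h1
      linarith
  obtain ⟨b, hb⟩ := exists_basis hD (by omega) hJ (n / 2 + 1) le_rfl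
  have hlow := expect_lower hD b (n / 2 + 1) (by omega) (by omega) hb
  have hvar := variance_le hD (by simp; omega)
  unfold gaussBeta
  rw [stdGaussian_eq]
  set I := ∫ x, N x ∂(ProbabilityTheory.stdGaussian (EuclideanSpace ℝ (Fin n)))
  have hn1 : (1 : ℝ) < n := by exact_mod_cast hn
  have hlogn : 0 < Real.log n := Real.log_pos hn1
  have hlog : Real.log n ≤ 2 * Real.log ((n / 2 + 1 : ℕ) : ℝ) := by
    have h1 : (n : ℝ) ≤ ((n / 2 + 1 : ℕ) : ℝ) ^ 2 := by
      have : n ≤ (n / 2 + 1) ^ 2 := by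
        have h2 : n ≤ 2 * (n / 2) + 1 := by omega
        nlinarith
      exact_mod_cast this
    have h2 := Real.log_le_log (by linarith) h1
    rw [Real.log_pow] at h2
    exact_mod_cast h2
  have hsq : (1 - rexp (-kap)) ^ 2 * (Real.log n / 32) ≤ I ^ 2 := by
    have h1 := pow_le_pow_left₀ (by positivity) hlow 2
    rw [mul_pow, div_pow, Real.sq_sqrt (by linarith)] at h1
    refine le_trans (mul_le_mul_of_nonneg_left ?_ (sq_nonneg _)) h1
    linarith
  have hIpos : 0 < (1 - rexp (-kap)) ^ 2 * (Real.log n / 32) := by positivity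
  calc _ ≤ 10 / ((1 - rexp (-kap)) ^ 2 * (Real.log n / 32)) := by gcongr
    _ = _ := by field_simp; norm_num
end

section
/- There is an absolute constant c > 0 such that: if X = (ℝⁿ, ‖·‖) is an n-dimensional normed space (n ≥ 2) whose unit ball B_X contains the Euclidean unit ball B₂ⁿ and B₂ⁿ is the ellipsoid of maximal volume contained in B_X (i.e., every affine image E = T(B₂ⁿ) + a, T invertible linear, with E ⊆ B_X satisfies |E| ≤ |B₂ⁿ|), then E‖Z‖ ≥ c·√(log n), where Z ~ γ_n. -/
open MeasureTheory ProbabilityTheory Real Set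

lemma dr_step (n : ℕ) (N : EuclideanSpace ℝ (Fin n) → ℝ)
    (hsm : ∀ (a : ℝ) (x), N (a • x) = |a| * N x)
    (hadd : ∀ x y, N (x + y) ≤ N x + N y)
    (hle : ∀ x, N x ≤ ‖x‖)
    (hmax : ∀ (T : EuclideanSpace ℝ (Fin n) ≃ₗ[ℝ] EuclideanSpace ℝ (Fin n))
            (a : EuclideanSpace ℝ (Fin n)),
          (∀ x ∈ Metric.closedBall (0 : EuclideanSpace ℝ (Fin n)) 1, N (T x + a) ≤ 1) →
          volume ((fun x => T x + a) '' Metric.closedBall (0 : EuclideanSpace ℝ (Fin n)) 1)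
            ≤ volume (Metric.closedBall (0 : EuclideanSpace ℝ (Fin n)) 1))
    (b : OrthonormalBasis (Fin n) ℝ (EuclideanSpace ℝ (Fin n))) (k : ℕ) (hk : 2 * k < n) :
    ∃ x, ‖x‖ = 1 ∧ (∀ i : Fin n, (i : ℕ) < k → inner ℝ (b i) x = 0) ∧ 1 / 2 ≤ N x := by
  by_contra! hcon
  have hF : ∀ w, (∀ i : Fin n, (i : ℕ) < k → inner ℝ (b i) w = 0) → N w ≤ 1 / 2 * ‖w‖ := by
    intro w hw
    by_cases h0 : w = 0
    · subst h0; simpa using hle 0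
    have hn : 0 < ‖w‖ := norm_pos_iff.2 h0
    have h1 := hcon (‖w‖⁻¹ • w) (by rw [norm_smul, norm_inv, norm_norm]; field_simp)
      (fun i hi => by rw [inner_smul_right, hw i hi, mul_zero])
    rw [hsm, abs_of_pos (inv_pos.2 hn), inv_mul_lt_iff₀ hn] at h1
    linarith
  obtain ⟨a, ha, haa⟩ : ∃ a : ℝ, 0 < a ∧ a * a = 1 / 2 :=
    ⟨√(1/2), by positivity, by rw [Real.mul_self_sqrt (by norm_num)]⟩
  set d : Fin n → ℝ := fun i => if (i : ℕ) < k then a else 2 * a with hd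
  set L := Matrix.toLin b.toBasis b.toBasis (Matrix.diagonal d) with hL
  have hdet : LinearMap.det L = a ^ k * (2 * a) ^ (n - k) := by
    have hc : (Finset.univ.filter (fun i : Fin n => (i : ℕ) < k)).card = k := by
      rw [Fin.card_filter_val_lt]; omega
    have hc' : (Finset.univ.filter (fun i : Fin n => ¬ (i : ℕ) < k)).card = n - k := by
      have := Finset.card_filter_add_card_filter_not (s := (Finset.univ : Finset (Fin n))) (fun i : Fin n => (i : ℕ) < k)
      rw [hc, Finset.card_univ, Fintype.card_fin] at this
      omega
    rw [hL, LinearMap.det_toLin, Matrix.det_diagonal, hd, Finset.prod_ite, Finset.prod_const,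
      Finset.prod_const, hc, hc']
  have hdet1 : 1 < LinearMap.det L := by
    obtain ⟨m, rfl⟩ : ∃ m, n = k + k + (m + 1) := ⟨n - 2 * k - 1, by omega⟩
    rw [hdet, show k + k + (m + 1) - k = k + (m + 1) by omega, pow_add, ← mul_assoc, ← mul_pow,
      show a * (2 * a) = 1 by linarith, one_pow, one_mul]
    exact one_lt_pow₀ (by nlinarith) (by omega)
  have hdet0 : LinearMap.det L ≠ 0 := by positivity
  have hLx : ∀ x, L x = ∑ i, (d i * inner ℝ (b i) x) • b i := by
    intro x
    conv_lhs => rw [← b.sum_repr' x]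
    rw [map_sum]
    refine Finset.sum_congr rfl fun i _ => ?_
    rw [map_smul]
    have : L (b i) = d i • b i := by
      have := Matrix.toLin_self b.toBasis b.toBasis (Matrix.diagonal d) i
      rw [hL]
      simpa [Matrix.diagonal_apply] using this
    rw [this, smul_smul, mul_comm]
  have key := hmax (LinearMap.equivOfDetNeZero L hdet0) 0 (by
    intro x hx
    have hx1 : ‖x‖ ≤ 1 := by simpa using hx
    change N (L x + 0) ≤ 1
    rw [add_zero]
    set w : EuclideanSpace ℝ (Fin n) := ∑ i : Fin n, (if (i : ℕ) < k then 0 else inner ℝ (b i) x) • b i with hw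
    set u : EuclideanSpace ℝ (Fin n) := ∑ i : Fin n, (if (i : ℕ) < k then inner ℝ (b i) x else 0) • b i with hu
    have hwi : ∀ i, inner ℝ (b i) w = if (i : ℕ) < k then 0 else inner ℝ (b i) x := fun i =>
      b.orthonormal.inner_right_fintype _ i
    have hui : ∀ i, inner ℝ (b i) u = if (i : ℕ) < k then inner ℝ (b i) x else 0 := fun i =>
      b.orthonormal.inner_right_fintype _ i
    have hLuw : L x = a • u + (2 * a) • w := by
      rw [hLx, hu, hw, Finset.smul_sum, Finset.smul_sum, ← Finset.sum_add_distrib]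
      refine Finset.sum_congr rfl fun i _ => ?_
      simp only [hd]
      split_ifs <;> simp [smul_smul]
    have hn : ‖u‖ ^ 2 + ‖w‖ ^ 2 = ‖x‖ ^ 2 := by
      rw [← b.sum_sq_inner_right u, ← b.sum_sq_inner_right w, ← b.sum_sq_inner_right x,
        ← Finset.sum_add_distrib]
      refine Finset.sum_congr rfl fun i _ => ?_
      rw [hui, hwi]
      split_ifs <;> simp
    have h1 : N w ≤ 1 / 2 * ‖w‖ := hF w (fun i hi => by rw [hwi, if_pos hi])
    have h2 := hadd (a • u) ((2 * a) • w)
    rw [← hLuw, hsm, hsm, abs_of_pos ha, abs_of_pos (by positivity : 0 < 2 * a)] at h2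
    have h3 := hle u
    have h4 : N (L x) ≤ a * (‖u‖ + ‖w‖) := by nlinarith
    refine h4.trans ?_
    have h5 : (a * (‖u‖ + ‖w‖)) ^ 2 ≤ 1 := by
      have : (a * (‖u‖ + ‖w‖)) ^ 2 = 1 / 2 * (‖u‖ + ‖w‖) ^ 2 := by rw [← haa]; ring
      rw [this]
      have := norm_nonneg x
      nlinarith [sq_nonneg (‖u‖ - ‖w‖)]
    exact (sq_le_one_iff₀ (by positivity)).1 h5)
  have himg : (fun x => (LinearMap.equivOfDetNeZero L hdet0) x + 0) ''
      Metric.closedBall (0 : EuclideanSpace ℝ (Fin n)) 1 =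
      L '' Metric.closedBall (0 : EuclideanSpace ℝ (Fin n)) 1 := by
    ext y; simp only [add_zero]; rfl
  rw [himg, Measure.addHaar_image_linearMap] at key
  have hpos : volume (Metric.closedBall (0 : EuclideanSpace ℝ (Fin n)) 1) ≠ 0 :=
    (Metric.measure_closedBall_pos volume _ one_pos).ne'
  have hfin : volume (Metric.closedBall (0 : EuclideanSpace ℝ (Fin n)) 1) ≠ ⊤ :=
    measure_closedBall_lt_top.ne
  have : ENNReal.ofReal |LinearMap.det L| ≤ 1 := by
    by_contra! h
    have := ENNReal.mul_lt_mul_left hpos hfin h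
    rw [one_mul] at this
    exact absurd key (not_le.2 this)
  rw [ENNReal.ofReal_le_one, abs_of_pos (by positivity)] at this
  linarith

lemma dr_basis (n : ℕ) (N : EuclideanSpace ℝ (Fin n) → ℝ)
    (hstep : ∀ (b : OrthonormalBasis (Fin n) ℝ (EuclideanSpace ℝ (Fin n))) (k : ℕ), 2 * k < n →
      ∃ x, ‖x‖ = 1 ∧ (∀ i : Fin n, (i : ℕ) < k → inner ℝ (b i) x = 0) ∧ 1 / 2 ≤ N x)
    (k : ℕ) (hk : 2 * k ≤ n + 1) :
    ∃ b : OrthonormalBasis (Fin n) ℝ (EuclideanSpace ℝ (Fin n)),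
      ∀ i : Fin n, (i : ℕ) < k → 1 / 2 ≤ N (b i) := by
  induction k with
  | zero => exact ⟨EuclideanSpace.basisFun _ _, by simp⟩
  | succ k ih =>
    obtain ⟨b, hb⟩ := ih (by omega)
    obtain ⟨x, hx1, hx2, hx3⟩ := hstep b k (by omega)
    have hv : Orthonormal ℝ (Set.domRestrict {i : Fin n | (i : ℕ) < k + 1}
        (Function.update b ⟨k, by omega⟩ x)) := by
      have hne : ∀ i : Fin n, (i : ℕ) < k → i ≠ ⟨k, by omega⟩ := by
        rintro i hi rfl; simp at hi
      have hcase : ∀ i : Fin n, (i : ℕ) < k + 1 → (i : ℕ) < k ∨ i = ⟨k, by omega⟩ := by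
        intro i hi
        rcases Nat.lt_succ_iff_lt_or_eq.1 hi with h | h
        · exact Or.inl h
        · exact Or.inr (Fin.ext h)
      constructor
      · rintro ⟨i, hi⟩
        rcases hcase i hi with h | h
        · simp [Set.domRestrict, Function.update_of_ne (hne i h)]
        · subst h; simpa [Set.domRestrict] using hx1
      · rintro ⟨i, hi⟩ ⟨j, hj⟩ hij
        have hij' : i ≠ j := fun h => hij (Subtype.ext h)
        simp only [Set.domRestrict]
        rcases hcase i hi with h | h <;> rcases hcase j hj with h' | h'
        · rw [Function.update_of_ne (hne i h), Function.update_of_ne (hne j h')]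
          exact b.orthonormal.2 hij'
        · subst h'
          rw [Function.update_of_ne (hne i h), Function.update_self]
          exact hx2 i h
        · subst h
          rw [Function.update_of_ne (hne j h'), Function.update_self, real_inner_comm]
          exact hx2 j h'
        · exact absurd (h.trans h'.symm) hij'
    obtain ⟨b', hb'⟩ := hv.exists_orthonormalBasis_extension_of_card_eq (by simp)
    refine ⟨b', fun i hi => ?_⟩
    rw [hb' i hi]
    by_cases h : i = ⟨k, by omega⟩
    · rw [h, Function.update_self]; exact hx3
    · rw [Function.update_of_ne h]
      refine hb i ?_
      have : (i : ℕ) ≠ k := fun h' => h (Fin.ext h')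
      omega

lemma gauss_tail (t : ℝ) (ht : 0 ≤ t) :
    (√(2 * π))⁻¹ * Real.exp (-t ^ 2 - 1) ≤ (gaussianReal 0 1).real {x : ℝ | t ≤ |x|} := by
  have h1 : (gaussianReal 0 1).real (Set.Icc t (t + 1)) ≤ (gaussianReal 0 1).real {x : ℝ | t ≤ |x|} :=
    measureReal_mono (fun x hx => hx.1.trans (le_abs_self x)) (measure_ne_top _ _)
  refine le_trans ?_ h1
  rw [measureReal_def, gaussianReal_apply_eq_integral _ (by simp),
    ENNReal.toReal_ofReal (integral_nonneg fun x => gaussianPDFReal_nonneg _ _ _)]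
  have h2 : ∫ x in Set.Icc t (t + 1), (√(2 * π))⁻¹ * Real.exp (-t ^ 2 - 1) ≤
      ∫ x in Set.Icc t (t + 1), gaussianPDFReal 0 1 x := by
    refine setIntegral_mono_on ?_ (integrable_gaussianPDFReal _ _).integrableOn measurableSet_Icc ?_
    · exact integrableOn_const (by simp)
    · intro x hx
      simp only [gaussianPDFReal, NNReal.coe_one, mul_one, sub_zero]
      gcongr
      nlinarith [hx.1, hx.2, sq_nonneg (t - 1)]
  simpa using h2

lemma sign_avg {E : Type*} [AddCommGroup E] [Module ℝ E] {n : ℕ} (N : E → ℝ)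
    (hsm : ∀ (a : ℝ) (x), N (a • x) = |a| * N x)
    (hadd : ∀ x y, N (x + y) ≤ N x + N y) (b : Fin n → E) (g : Fin n → ℝ) (i : Fin n) :
    (Fintype.card (Fin n → ℤˣ) : ℝ) * (|g i| * N (b i)) ≤
      ∑ s : Fin n → ℤˣ, N (∑ j, (((s j : ℤ) : ℝ) * g j) • b j) := by
  set f : Fin n → ℤˣ := fun j => if j = i then 1 else -1 with hf
  have h1 : ∑ s : Fin n → ℤˣ, N (∑ j, (((s j : ℤ) : ℝ) * g j) • b j) =
      ∑ s : Fin n → ℤˣ, N (∑ j, ((((s * f) j : ℤˣ) : ℤ) : ℝ) • (g j • b j)) := by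
    simp_rw [mul_smul]
    exact (Equiv.sum_comp (Equiv.mulRight f)
      (fun s : Fin n → ℤˣ => N (∑ j, ((s j : ℤ) : ℝ) • (g j • b j)))).symm
  have h2 : (Fintype.card (Fin n → ℤˣ) : ℝ) * (2 * (|g i| * N (b i))) ≤
      ∑ s : Fin n → ℤˣ, N (∑ j, (((s j : ℤ) : ℝ) * g j) • b j) +
      ∑ s : Fin n → ℤˣ, N (∑ j, ((((s * f) j : ℤˣ) : ℤ) : ℝ) • (g j • b j)) := by
    rw [← Finset.sum_add_distrib, ← nsmul_eq_mul, ← Finset.card_univ]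
    refine Finset.card_nsmul_le_sum _ _ _ fun s _ => ?_
    refine le_trans (le_of_eq ?_) (hadd _ _)
    rw [← Finset.sum_add_distrib, Finset.sum_eq_single i]
    · rw [mul_smul, ← add_smul, hsm, hsm]
      rcases Int.units_eq_one_or (s i) with h | h <;> simp [hf, h] <;> norm_num
    · intro j _ hj
      simp [hf, hj, mul_smul]
    · simp
  rw [← h1] at h2
  linarith

lemma prob_max (n : ℕ) (k : ℕ) (hkn : k ≤ n) (t : ℝ) :
    (Measure.pi fun _ : Fin n => gaussianReal 0 1).real
      {g | ∀ i : Fin n, (i : ℕ) < k → |g i| < t} =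
      (1 - (gaussianReal 0 1).real {x : ℝ | t ≤ |x|}) ^ k := by
  have hset : {g : Fin n → ℝ | ∀ i : Fin n, (i : ℕ) < k → |g i| < t} =
      Set.univ.pi (fun i : Fin n => if (i : ℕ) < k then {x : ℝ | t ≤ |x|}ᶜ else Set.univ) := by
    ext g
    simp only [Set.mem_setOf_eq, Set.mem_pi, Set.mem_univ, true_implies]
    refine forall_congr' fun i => ?_
    split_ifs with h <;> simp [h]
  have hm : MeasurableSet {x : ℝ | t ≤ |x|} := measurableSet_le measurable_const (by fun_prop)
  rw [hset, measureReal_def, Measure.pi_pi, ENNReal.toReal_prod]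
  have : ∀ i : Fin n, ((gaussianReal 0 1) (if (i : ℕ) < k then {x : ℝ | t ≤ |x|}ᶜ else Set.univ)).toReal
      = if (i : ℕ) < k then (1 - (gaussianReal 0 1).real {x : ℝ | t ≤ |x|}) else 1 := by
    intro i
    split_ifs
    · rw [← measureReal_def, probReal_compl_eq_one_sub hm]
    · simp
  simp_rw [this]
  rw [Finset.prod_ite, Finset.prod_const, Finset.prod_const_one, mul_one, Fin.card_filter_val_lt,
    min_eq_right hkn]

lemma integral_lower (n : ℕ) (k : ℕ) (hkn : k ≤ n) (t : ℝ) (ht : 0 ≤ t)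
    (N : EuclideanSpace ℝ (Fin n) → ℝ)
    (hsm : ∀ (a : ℝ) (x), N (a • x) = |a| * N x)
    (hadd : ∀ x y, N (x + y) ≤ N x + N y)
    (hnn : ∀ x, 0 ≤ N x)
    (hle : ∀ x, N x ≤ ‖x‖)
    (b : OrthonormalBasis (Fin n) ℝ (EuclideanSpace ℝ (Fin n)))
    (hb : ∀ i : Fin n, (i : ℕ) < k → 1 / 2 ≤ N (b i)) :
    t / 2 * (1 - (1 - (gaussianReal 0 1).real {x : ℝ | t ≤ |x|}) ^ k) ≤ ∫ x, N x ∂stdGaussian n := by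
  set P := Measure.pi fun _ : Fin n => gaussianReal 0 1 with hP
  have hcont : Continuous N := by
    have : LipschitzWith 1 N := LipschitzWith.of_le_add fun x y => by
      have h1 := hadd y (x - y)
      have h2 := hle (x - y)
      rw [add_sub_cancel] at h1
      rw [dist_eq_norm]
      linarith
    exact this.continuous
  have hμ : stdGaussian n = P.map (fun x ↦ ∑ i, x i • b i) := by
    rw [← stdGaussian_eq_map_pi_orthonormalBasis b, ← map_pi_eq_stdGaussian]
    rfl
  have hgi : ∀ i : Fin n, Integrable (fun g : Fin n → ℝ => g i) P := fun i =>
    integrable_eval IsGaussian.integrable_id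
  rw [hμ, integral_map (Measurable.aemeasurable (by fun_prop)) hcont.aestronglyMeasurable]
  set F : (Fin n → ℝ) → ℝ := fun g => N (∑ i, g i • b i) with hFdef
  have hFc : Continuous F := hcont.comp (by fun_prop)
  have hFi : Integrable F P := by
    have : Integrable (fun g : Fin n → ℝ => ∑ i, ‖g i‖) P :=
      integrable_finsetSum _ fun i _ => (hgi i).norm
    refine this.mono' hFc.aestronglyMeasurable (Filter.Eventually.of_forall fun g => ?_)
    rw [Real.norm_of_nonneg (hnn _)]
    refine (hle _).trans ((norm_sum_le _ _).trans ?_)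
    refine Finset.sum_le_sum fun i _ => ?_
    rw [norm_smul, b.orthonormal.1 i, mul_one]
  have hmp : ∀ s : Fin n → ℤˣ,
      MeasurePreserving (fun (g : Fin n → ℝ) j => ((s j : ℤ) : ℝ) * g j) P P := by
    intro s
    refine measurePreserving_pi _ _ fun j => ⟨by fun_prop, ?_⟩
    rcases Int.units_eq_one_or (s j) with h | h
    · have : (fun x : ℝ => ((s j : ℤ) : ℝ) * x) = id := by ext x; simp [h]
      exact (congrArg (fun f => (gaussianReal 0 1).map f) this).trans Measure.map_id
    · have : (fun x : ℝ => ((s j : ℤ) : ℝ) * x) = fun x => -x := by ext x; simp [h]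
      refine (congrArg (fun f => (gaussianReal 0 1).map f) this).trans ?_
      simpa using gaussianReal_map_neg (μ := 0) (v := 1)
  have hFs : ∀ s : Fin n → ℤˣ, Integrable (fun g => F (fun j => ((s j : ℤ) : ℝ) * g j)) P :=
    fun s => (hmp s).integrable_comp_of_integrable hFi
  have hIs : ∀ s : Fin n → ℤˣ, ∫ g, F (fun j => ((s j : ℤ) : ℝ) * g j) ∂P = ∫ g, F g ∂P := by
    intro s
    have := integral_map (μ := P) (hmp s).measurable.aemeasurable (f := F) hFc.aestronglyMeasurable
    rw [(hmp s).map_eq] at this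
    exact this.symm
  set A : Set (Fin n → ℝ) := {g | ∀ i : Fin n, (i : ℕ) < k → |g i| < t} with hA
  have hAm : MeasurableSet A := by
    rw [hA]
    simp only [Set.setOf_forall]
    exact MeasurableSet.iInter fun i => MeasurableSet.iInter fun _ =>
      measurableSet_lt (by fun_prop) measurable_const
  set C : ℝ := (Fintype.card (Fin n → ℤˣ) : ℝ) with hC
  have hCpos : 0 < C := by rw [hC]; exact_mod_cast Fintype.card_pos
  have hpt : ∀ g, Aᶜ.indicator (fun _ => C * (t / 2)) g ≤
      ∑ s : Fin n → ℤˣ, F (fun j => ((s j : ℤ) : ℝ) * g j) := by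
    intro g
    by_cases hg : g ∈ A
    · rw [Set.indicator_of_notMem (by simpa using hg)]
      exact Finset.sum_nonneg fun s _ => hnn _
    · rw [Set.indicator_of_mem hg]
      simp only [hA, Set.mem_setOf_eq, not_forall, not_lt] at hg
      obtain ⟨i, hi, hti⟩ := hg
      refine le_trans ?_ (sign_avg N hsm hadd b g i)
      refine mul_le_mul_of_nonneg_left ?_ hCpos.le
      have := hb i hi
      nlinarith
  have hint := integral_mono (μ := P) ((integrable_const _).indicator hAm.compl)
    (integrable_finsetSum _ fun s _ => hFs s) hpt
  rw [integral_finsetSum _ (fun s _ => hFs s), integral_indicator_const _ hAm.compl,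
    probReal_compl_eq_one_sub hAm, hA, hP, prob_max n k hkn t] at hint
  simp only [← hP] at hint
  simp_rw [hIs] at hint
  rw [Finset.sum_const, Finset.card_univ, nsmul_eq_mul, ← hC, smul_eq_mul] at hint
  refine le_of_mul_le_mul_left ?_ hCpos
  linarith

/-- If the unit ball of `X = (ℝⁿ, ‖·‖)` (with `n ≥ 2`) contains the
Euclidean unit ball `B₂ⁿ` and `B₂ⁿ` is the ellipsoid of maximal volume inside `B_X`,
then `E‖Z‖ ≥ c·√(log n)` for `Z ~ γ_n`, where `c > 0` is an absolute constant. -/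
theorem gaussian_mean_ge_of_john_position :
    ∃ c : ℝ, 0 < c ∧
      ∀ (n : ℕ), 2 ≤ n →
      ∀ N : EuclideanSpace ℝ (Fin n) → ℝ,
        (∀ x, x ≠ 0 → 0 < N x) →
        (∀ (a : ℝ) (x), N (a • x) = |a| * N x) →
        (∀ x y, N (x + y) ≤ N x + N y) →
        (∀ x : EuclideanSpace ℝ (Fin n), ‖x‖ ≤ 1 → N x ≤ 1) →
        (∀ (T : EuclideanSpace ℝ (Fin n) ≃ₗ[ℝ] EuclideanSpace ℝ (Fin n))
            (a : EuclideanSpace ℝ (Fin n)),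
          (∀ x ∈ Metric.closedBall (0 : EuclideanSpace ℝ (Fin n)) 1, N (T x + a) ≤ 1) →
          volume ((fun x => T x + a) '' Metric.closedBall (0 : EuclideanSpace ℝ (Fin n)) 1)
            ≤ volume (Metric.closedBall (0 : EuclideanSpace ℝ (Fin n)) 1)) →
        c * Real.sqrt (Real.log n) ≤ ∫ x, N x ∂stdGaussian n := by
  set q : ℝ := (√(2 * π))⁻¹ * Real.exp (-1) with hq
  have hqpos : 0 < q := by positivity
  refine ⟨(1 - Real.exp (-(q / 2))) / 2, ?_, ?_⟩
  · have : Real.exp (-(q / 2)) < 1 := by rw [Real.exp_lt_one_iff]; linarith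
    linarith
  intro n hn N hpos hsm hadd hball hmax
  have hN0 : N 0 = 0 := by simpa using hsm 0 0
  have hnn : ∀ x, 0 ≤ N x := fun x => by
    by_cases h : x = 0
    · rw [h, hN0]
    · exact (hpos x h).le
  have hle : ∀ x, N x ≤ ‖x‖ := fun x => by
    by_cases h : x = 0
    · rw [h, hN0, norm_zero]
    have hx : 0 < ‖x‖ := norm_pos_iff.2 h
    have h1 := hball (‖x‖⁻¹ • x) (by rw [norm_smul, norm_inv, norm_norm]; field_simp; rfl)
    rw [hsm, abs_of_pos (inv_pos.2 hx), inv_mul_le_iff₀ hx] at h1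
    linarith
  obtain ⟨b, hb⟩ := dr_basis n N (dr_step n N hsm hadd hle hmax) ((n + 1) / 2) (by omega)
  set t := √(Real.log n) with ht
  have hn0 : (0 : ℝ) < n := by exact_mod_cast (by omega : 0 < n)
  have hlog : 0 ≤ Real.log n := Real.log_natCast_nonneg n
  have ht0 : 0 ≤ t := Real.sqrt_nonneg _
  refine le_trans ?_ (integral_lower n ((n + 1) / 2) (by omega) t ht0 N hsm hadd hnn hle b hb)
  set p := (gaussianReal 0 1).real {x : ℝ | t ≤ |x|} with hp
  have hp1 : p ≤ 1 := measureReal_le_one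
  have hpq : q / n ≤ p := by
    have h := gauss_tail t ht0
    rw [ht, Real.sq_sqrt hlog, sub_eq_add_neg, Real.exp_add, Real.exp_neg, Real.exp_log hn0] at h
    refine le_trans (le_of_eq ?_) h
    rw [hq]; field_simp
  have hpow : (1 - p) ^ ((n + 1) / 2) ≤ Real.exp (-(q / 2)) := by
    have h1 : 1 - p ≤ Real.exp (-p) := by have := Real.add_one_le_exp (-p); linarith
    refine (pow_le_pow_left₀ (by linarith) h1 _).trans ?_
    rw [← Real.exp_nat_mul, Real.exp_le_exp]
    have h2 : (n : ℝ) / 2 ≤ ((n + 1) / 2 : ℕ) := by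
      have : n ≤ 2 * ((n + 1) / 2) := by omega
      have : (n : ℝ) ≤ 2 * ((n + 1) / 2 : ℕ) := by exact_mod_cast this
      linarith
    have h3 : (n : ℝ) / 2 * (q / n) ≤ ((n + 1) / 2 : ℕ) * p :=
      mul_le_mul h2 hpq (by positivity) (by positivity)
    have h4 : (n : ℝ) / 2 * (q / n) = q / 2 := by field_simp
    linarith
  nlinarith
end

section
/- There exist absolute constants c, C > 0 such that for every finite-dimensional normed space X = (ℝⁿ, ‖·‖): c·log(1/β(X)) ≤ k(X) ≤ C/β(X), where k(X) = n(M(X)/b(X))² is the Dvoretzky number of X. -/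
open MeasureTheory ProbabilityTheory Real Set

/-- The rotation-invariant (uniform) probability measure `σ` on the Euclidean unit sphere
`S^{n−1}`, viewed as a measure on `ℝⁿ` supported on the sphere. -/
noncomputable def uniformSphere (n : ℕ) : Measure (EuclideanSpace ℝ (Fin n)) :=
  (((volume : Measure (EuclideanSpace ℝ (Fin n))).toSphere Set.univ)⁻¹ •
    (volume : Measure (EuclideanSpace ℝ (Fin n))).toSphere).map Subtype.val

/-- `M(X) = ∫_{S^{n−1}} ‖θ‖ dσ(θ)`. -/
noncomputable def sphereMean {n : ℕ} (N : EuclideanSpace ℝ (Fin n) → ℝ) : ℝ :=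
  ∫ θ, N θ ∂uniformSphere n

/-- `b(X) = max_{θ ∈ S^{n−1}} ‖θ‖`. -/
noncomputable def sphereMax {n : ℕ} (N : EuclideanSpace ℝ (Fin n) → ℝ) : ℝ :=
  sSup {r : ℝ | ∃ θ : EuclideanSpace ℝ (Fin n), ‖θ‖ = 1 ∧ r = N θ}

/-- The Dvoretzky number `k(X) = n (M(X)/b(X))²`. -/
noncomputable def dvoretzkyDim {n : ℕ} (N : EuclideanSpace ℝ (Fin n) → ℝ) : ℝ :=
  n * (sphereMean N / sphereMax N) ^ 2

namespace DvProof

open Filter Topology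
open scoped ENNReal NNReal RealInnerProductSpace

/-- The Euclidean space of dimension `n`. -/
abbrev Eu (n : ℕ) := EuclideanSpace ℝ (Fin n)

/-- Mathlib's standard Gaussian measure. -/
noncomputable abbrev gam (n : ℕ) : Measure (Eu n) := ProbabilityTheory.stdGaussian (Eu n)

lemma std_eq (n : ℕ) : _root_.stdGaussian n = gam n := by
  unfold _root_.stdGaussian gam
  rw [← ProbabilityTheory.map_pi_eq_stdGaussian]
  rfl

lemma pi_density (n : ℕ) : (Measure.pi fun _ : Fin n => gaussianReal 0 1) =
    (volume : Measure (Fin n → ℝ)).withDensity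
      (fun x => ENNReal.ofReal (∏ i, gaussianPDFReal 0 1 (x i))) := by
  apply Measure.pi_eq
  intro s hs
  rw [withDensity_apply _ (MeasurableSet.univ_pi hs)]
  have h1 : ∀ i, gaussianReal 0 1 (s i) =
      ENNReal.ofReal (∫ x, (s i).indicator (gaussianPDFReal 0 1) x) := by
    intro i
    rw [gaussianReal_apply_eq_integral _ (by norm_num), integral_indicator (hs i)]
  simp_rw [h1]
  rw [← ENNReal.ofReal_prod_of_nonneg]
  · rw [← integral_fintype_prod_volume_eq_prod (𝕜 := ℝ)]
    rw [ofReal_integral_eq_lintegral_ofReal]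
    · rw [← lintegral_indicator (MeasurableSet.univ_pi hs)]
      congr 1
      ext x
      by_cases hx : x ∈ Set.univ.pi s
      · rw [Set.indicator_of_mem hx]
        congr 1
        refine Finset.prod_congr rfl fun i _ => ?_
        rw [Set.indicator_of_mem (hx i (mem_univ i))]
      · rw [Set.indicator_of_notMem hx]
        simp only [Set.mem_pi, mem_univ, true_imp_iff, not_forall] at hx
        obtain ⟨i, hi⟩ := hx
        rw [Finset.prod_eq_zero (Finset.mem_univ i) (Set.indicator_of_notMem hi _)]
        simp
    · exact Integrable.fintype_prod (fun i => (integrable_gaussianPDFReal 0 1).indicator (hs i))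
    · refine Eventually.of_forall fun x => Finset.prod_nonneg fun i _ => ?_
      exact Set.indicator_nonneg (fun x _ => gaussianPDFReal_nonneg 0 1 x) _
  · intro i _
    exact integral_nonneg fun x => Set.indicator_nonneg (fun x _ => gaussianPDFReal_nonneg 0 1 x) _

lemma integral_gam (n : ℕ) : ∃ K : ℝ, ∀ f : Eu n → ℝ,
    ∫ x, f x ∂gam n = ∫ x, (K * Real.exp (-‖x‖^2/2)) * f x := by
  refine ⟨(√(2*π))⁻¹ ^ n, fun f => ?_⟩
  rw [gam, ← ProbabilityTheory.map_pi_eq_stdGaussian, pi_density]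
  have he : MeasurableEmbedding (WithLp.toLp 2 : (Fin n → ℝ) → Eu n) :=
    (MeasurableEquiv.toLp 2 (Fin n → ℝ)).measurableEmbedding
  rw [he.integral_map]
  rw [← (PiLp.volume_preserving_toLp (Fin n)).integral_comp he]
  rw [integral_withDensity_eq_integral_toReal_smul]
  · congr 1
    ext x
    rw [ENNReal.toReal_ofReal (Finset.prod_nonneg fun i _ => gaussianPDFReal_nonneg 0 1 _)]
    simp only [gaussianPDFReal, smul_eq_mul, Finset.prod_mul_distrib]
    congr 1
    simp [← Real.exp_sum, EuclideanSpace.norm_sq_eq, Finset.sum_div, neg_div]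
  · have : Measurable (gaussianPDFReal 0 1) := measurable_gaussianPDFReal 0 1
    fun_prop
  · exact Eventually.of_forall fun x => ENNReal.ofReal_lt_top

lemma sphereMean_eq {n : ℕ} (N : Eu n → ℝ) : sphereMean N =
    ((volume : Measure (Eu n)).toSphere Set.univ)⁻¹.toReal *
      ∫ θ, N θ ∂(volume : Measure (Eu n)).toSphere := by
  unfold sphereMean uniformSphere
  rw [(MeasurableEmbedding.subtype_coe Metric.isClosed_sphere.measurableSet).integral_map,
    integral_smul_measure]
  rfl

lemma polar (n : ℕ) (hn : 0 < n) : ∃ ρ : ℝ, ∀ N : Eu n → ℝ,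
    (∀ (a : ℝ) (x), N (a • x) = |a| * N x) → ∫ x, N x ∂gam n = ρ * sphereMean N := by
  have : Nonempty (Fin n) := ⟨⟨0, hn⟩⟩
  have : Nontrivial (Eu n) := inferInstance
  obtain ⟨K, hK⟩ := integral_gam n
  set S := (volume : Measure (Eu n)).toSphere
  have hS0 : S Set.univ ≠ 0 := by
    rw [Ne, Measure.measure_univ_eq_zero]; exact Measure.toSphere_ne_zero _
  have hS1 : S Set.univ ≠ ∞ := measure_ne_top _ _
  refine ⟨(S Set.univ).toReal * ∫ r : Ioi (0:ℝ), (K * Real.exp (-r.1^2/2)) * r.1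
    ∂(Measure.volumeIoiPow (Module.finrank ℝ (Eu n) - 1)), fun N hN => ?_⟩
  rw [hK, sphereMean_eq, show (volume : Measure (Eu n)).toSphere = S from rfl]
  have key : ∫ x, K * Real.exp (-‖x‖^2/2) * N x = ∫ p, N p.1 * ((K * Real.exp (-p.2.1^2/2)) * p.2.1)
     ∂S.prod (Measure.volumeIoiPow (Module.finrank ℝ (Eu n) - 1)) := by
    have k1 : ∫ x : Eu n, K * Real.exp (-‖x‖^2/2) * N x =
        ∫ x : ({0}ᶜ : Set (Eu n)), K * Real.exp (-‖x.1‖^2/2) * N x.1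
          ∂(volume : Measure (Eu n)).comap (↑) := by
      rw [integral_subtype_comap (measurableSet_singleton (0 : Eu n)).compl
        (fun x => K * Real.exp (-‖x‖^2/2) * N x), restrict_compl_singleton]
    rw [k1, ← ((volume : Measure (Eu n)).measurePreserving_homeomorphUnitSphereProd).integral_comp
        (Homeomorph.measurableEmbedding (homeomorphUnitSphereProd (Eu n)))]
    congr 1
    funext x
    have hx : ‖(x : Eu n)‖ ≠ 0 := norm_ne_zero_iff.2 x.2
    simp only [homeomorphUnitSphereProd_apply_fst_coe, homeomorphUnitSphereProd_apply_snd_coe]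
    rw [hN, abs_inv, abs_norm]
    field_simp
  rw [key, integral_prod_mul (f := fun p : Metric.sphere (0 : Eu n) 1 => N p)
    (g := fun r : Ioi (0:ℝ) => (K * Real.exp (-r.1^2/2)) * r.1)]
  rw [ENNReal.toReal_inv]
  have : (S Set.univ).toReal ≠ 0 := ENNReal.toReal_ne_zero.2 ⟨hS0, hS1⟩
  field_simp

lemma polar' (n : ℕ) (hn : 0 < n) (N : Eu n → ℝ)
    (hN : ∀ (a : ℝ) (x), N (a • x) = |a| * N x) :
    ∫ x, N x ∂gam n = (∫ x, ‖x‖ ∂gam n) * sphereMean N := by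
  have : Nonempty (Fin n) := ⟨⟨0, hn⟩⟩
  have : Nontrivial (Eu n) := inferInstance
  obtain ⟨ρ, hρ⟩ := polar n hn
  rw [hρ N hN, hρ (fun x => ‖x‖) (fun a x => by rw [norm_smul, Real.norm_eq_abs]), sphereMean_eq (fun x => ‖x‖)]
  set S := (volume : Measure (Eu n)).toSphere
  have hS0 : S Set.univ ≠ 0 := by
    rw [Ne, Measure.measure_univ_eq_zero]; exact Measure.toSphere_ne_zero _
  have hS1 : S Set.univ ≠ ∞ := measure_ne_top _ _
  have : (S Set.univ).toReal ≠ 0 := ENNReal.toReal_ne_zero.2 ⟨hS0, hS1⟩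
  have h1 : ∀ θ : Metric.sphere (0 : Eu n) 1, ‖(θ : Eu n)‖ = 1 := fun θ => by
    simp
  simp only [h1, integral_const, smul_eq_mul, Measure.real, mul_one, ENNReal.toReal_inv]
  field_simp

/-- The hypotheses that `N` is a norm. -/
structure IsNm {n : ℕ} (N : Eu n → ℝ) : Prop where
  pos : ∀ x, x ≠ 0 → 0 < N x
  hom : ∀ (a : ℝ) (x), N (a • x) = |a| * N x
  add : ∀ x y, N (x + y) ≤ N x + N y

namespace IsNm

variable {n : ℕ} {N : Eu n → ℝ}

lemma zero (h : IsNm N) : N 0 = 0 := by simpa using h.hom 0 0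

lemma nonneg (h : IsNm N) (x : Eu n) : 0 ≤ N x := by
  by_cases hx : x = 0
  · rw [hx, h.zero]
  · exact (h.pos x hx).le

lemma neg (h : IsNm N) (x : Eu n) : N (-x) = N x := by simpa using h.hom (-1) x

lemma bdd (h : IsNm N) : ∃ B : ℝ, 0 ≤ B ∧ ∀ x, N x ≤ B * ‖x‖ := by
  refine ⟨∑ i, N (EuclideanSpace.basisFun (Fin n) ℝ i), Finset.sum_nonneg fun i _ => h.nonneg _,
    fun x => ?_⟩
  have hs : ∀ (s : Finset (Fin n)) (f : Fin n → Eu n), N (∑ i ∈ s, f i) ≤ ∑ i ∈ s, N (f i) := by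
    intro s f
    exact Finset.le_sum_of_subadditive N h.zero.le h.add s f
  have hx : x = ∑ i, x i • EuclideanSpace.basisFun (Fin n) ℝ i := by
    have := (EuclideanSpace.basisFun (Fin n) ℝ).sum_repr x
    simpa using this.symm
  calc N x = N (∑ i, x i • EuclideanSpace.basisFun (Fin n) ℝ i) := by rw [← hx]
    _ ≤ ∑ i, N (x i • EuclideanSpace.basisFun (Fin n) ℝ i) := hs _ _
    _ ≤ ∑ i, N (EuclideanSpace.basisFun (Fin n) ℝ i) * ‖x‖ := by
        refine Finset.sum_le_sum fun i _ => ?_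
        rw [h.hom, mul_comm]
        exact mul_le_mul_of_nonneg_left (PiLp.norm_apply_le x i) (h.nonneg _)
    _ = _ := by rw [Finset.sum_mul]

lemma cont (h : IsNm N) : Continuous N := by
  obtain ⟨B, hB, hb⟩ := h.bdd
  have : LipschitzWith ⟨B, hB⟩ N := by
    refine LipschitzWith.of_le_add_mul _ fun x y => ?_
    have h1 := h.add y (x - y)
    have h2 := hb (x - y)
    rw [add_sub_cancel] at h1
    rw [dist_eq_norm]
    change N x ≤ N y + B * ‖x - y‖
    linarith
  exact this.continuous

lemma exists_max (h : IsNm N) (hn : 0 < n) : ∃ θ : Eu n, ‖θ‖ = 1 ∧ sphereMax N = N θ ∧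
    ∀ x, N x ≤ sphereMax N * ‖x‖ := by
  have : Nonempty (Fin n) := ⟨⟨0, hn⟩⟩
  have : Nontrivial (Eu n) := inferInstance
  obtain ⟨θ, hθ, hm⟩ := (isCompact_sphere (0 : Eu n) 1).exists_isMaxOn
    (NormedSpace.sphere_nonempty.2 zero_le_one) h.cont.continuousOn
  have hθ1 : ‖θ‖ = 1 := by simpa using hθ
  have hmx : ∀ y : Eu n, ‖y‖ = 1 → N y ≤ N θ := fun y hy => hm (by simpa using hy)
  have hs : sphereMax N = N θ := by
    refine IsGreatest.csSup_eq ⟨⟨θ, hθ1, rfl⟩, ?_⟩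
    rintro r ⟨y, hy, rfl⟩
    exact hmx y hy
  refine ⟨θ, hθ1, hs, fun x => ?_⟩
  rw [hs]
  by_cases hx : x = 0
  · simp [hx, h.zero]
  · have hx' : ‖x‖ ≠ 0 := norm_ne_zero_iff.2 hx
    have := hmx (‖x‖⁻¹ • x) (by rw [norm_smul, norm_inv, norm_norm]; field_simp)
    rw [h.hom, abs_inv, abs_norm, inv_mul_le_iff₀ (by positivity)] at this
    linarith

lemma supp (h : IsNm N) (x : Eu n) : ∃ L : StrongDual ℝ (Eu n), L x = N x ∧ ∀ y, L y ≤ N y := by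
  by_cases hx : x = 0
  · exact ⟨0, by simp [hx, h.zero], fun y => by simpa using h.nonneg y⟩
  obtain ⟨g, hg1, hg2⟩ := exists_extension_of_le_sublinear
    (LinearPMap.mkSpanSingleton x (N x) hx) N
    (fun c hc x => by rw [h.hom, abs_of_pos hc]) h.add (by
      rintro ⟨y, hy⟩
      obtain ⟨c, rfl⟩ := Submodule.mem_span_singleton.1 hy
      erw [LinearPMap.mkSpanSingleton'_apply]
      simp only [RingHom.id_apply, smul_eq_mul]
      rw [h.hom]
      exact mul_le_mul_of_nonneg_right (le_abs_self c) (h.nonneg x))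
  refine ⟨LinearMap.toContinuousLinearMap g, ?_, fun y => hg2 y⟩
  have := hg1 ⟨x, Submodule.mem_span_singleton_self x⟩
  erw [LinearPMap.mkSpanSingleton'_apply_self] at this
  exact this

lemma abs_le_of_supp (h : IsNm N) {L : StrongDual ℝ (Eu n)} (hL : ∀ y, L y ≤ N y) (y : Eu n) : |L y| ≤ N y := by
  rw [abs_le]
  have := hL (-y)
  rw [h.neg, map_neg] at this
  exact ⟨by linarith, hL y⟩

lemma norm_supp_le (h : IsNm N) (hn : 0 < n) {L : StrongDual ℝ (Eu n)} (hL : ∀ y, L y ≤ N y) :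
    ‖L‖ ≤ sphereMax N := by
  obtain ⟨θ, h1, h2, h3⟩ := h.exists_max hn
  refine L.opNorm_le_bound (by rw [h2]; exact h.nonneg _) fun y => ?_
  exact (h.abs_le_of_supp hL y).trans (h3 y)

lemma memLp_comp (h : IsNm N) (A : Eu n × Eu n →L[ℝ] Eu n) :
    MemLp (fun p => N (A p)) 2 ((gam n).prod (gam n)) := by
  obtain ⟨B, hB, hb⟩ := h.bdd
  have h1 : MemLp (fun p : Eu n × Eu n => (B * ‖A‖) * ‖p‖) 2 ((gam n).prod (gam n)) :=
    (IsGaussian.memLp_two_id (μ := (gam n).prod (gam n))).norm.const_mul _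
  refine h1.mono (h.cont.comp A.continuous).aestronglyMeasurable (Eventually.of_forall fun p => ?_)
  rw [Real.norm_of_nonneg (h.nonneg _), Real.norm_of_nonneg (by positivity)]
  calc N (A p) ≤ B * ‖A p‖ := hb _
    _ ≤ B * (‖A‖ * ‖p‖) := by gcongr; exact A.le_opNorm p
    _ = _ := by ring

lemma memLp (h : IsNm N) : MemLp N 2 (gam n) := by
  obtain ⟨B, hB, hb⟩ := h.bdd
  have h1 : MemLp (fun p : Eu n => B * ‖p‖) 2 (gam n) :=
    (IsGaussian.memLp_two_id (μ := gam n)).norm.const_mul _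
  refine h1.mono h.cont.aestronglyMeasurable (Eventually.of_forall fun p => ?_)
  rw [Real.norm_of_nonneg (h.nonneg _), Real.norm_of_nonneg (by positivity)]
  exact hb p

end IsNm

/-- First component of the rotation. -/
noncomputable def rot (n : ℕ) (θ : ℝ) : Eu n × Eu n →L[ℝ] Eu n :=
  Real.cos θ • ContinuousLinearMap.fst ℝ (Eu n) (Eu n) +
    Real.sin θ • ContinuousLinearMap.snd ℝ (Eu n) (Eu n)

lemma rot_apply (n : ℕ) (θ : ℝ) (p : Eu n × Eu n) :
    rot n θ p = Real.cos θ • p.1 + Real.sin θ • p.2 := rfl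

lemma rot_fst (n : ℕ) (θ : ℝ) (p : Eu n × Eu n) :
    (ContinuousLinearMap.rotation θ p).1 = rot n θ p := rfl

lemma rot_rotation (n : ℕ) (θ φ : ℝ) (p : Eu n × Eu n) :
    rot n φ (ContinuousLinearMap.rotation θ p) = rot n (θ + φ) p := by
  rw [ContinuousLinearMap.rotation_apply, rot_apply, rot_apply, Real.cos_add, Real.sin_add]
  module

lemma mp_rot (n : ℕ) (θ : ℝ) : MeasurePreserving
    (ContinuousLinearMap.rotation θ : Eu n × Eu n →L[ℝ] Eu n × Eu n)
    ((gam n).prod (gam n)) ((gam n).prod (gam n)) :=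
  ⟨by fun_prop, IsGaussian.map_rotation_eq_self_of_forall_strongDual_eq_zero
    (fun L => integral_strongDual_stdGaussian L) θ⟩

lemma integral_rot (n : ℕ) (θ : ℝ) {f : Eu n × Eu n → ℝ} (hf : Continuous f) :
    ∫ p, f (ContinuousLinearMap.rotation θ p) ∂(gam n).prod (gam n) =
      ∫ p, f p ∂(gam n).prod (gam n) := by
  have := mp_rot n θ
  conv_rhs => rw [← this.map_eq]
  rw [integral_map this.measurable.aemeasurable hf.aestronglyMeasurable]

/-- The squared displacement. -/
noncomputable def Dsp {n : ℕ} (N : Eu n → ℝ) (θ : ℝ) : ℝ :=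
  ∫ p, (N p.1 - N (rot n θ p)) ^ 2 ∂(gam n).prod (gam n)

namespace IsNm

variable {n : ℕ} {N : Eu n → ℝ}

lemma memLp_diff (h : IsNm N) (θ : ℝ) :
    MemLp (fun p => N p.1 - N (rot n θ p)) 2 ((gam n).prod (gam n)) :=
  (h.memLp_comp (ContinuousLinearMap.fst ℝ (Eu n) (Eu n))).sub (h.memLp_comp (rot n θ))

lemma dsp_double (h : IsNm N) (θ : ℝ) : Dsp N (2 * θ) ≤ 4 * Dsp N θ := by
  have hc := h.cont
  have e1 : Dsp N θ = ∫ p, (N (rot n θ p) - N (rot n (2 * θ) p)) ^ 2 ∂(gam n).prod (gam n) := by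
    unfold Dsp
    rw [← integral_rot n θ (f := fun p => (N p.1 - N (rot n θ p)) ^ 2) (by fun_prop)]
    simp only [rot_rotation, rot_fst, two_mul]
  have i1 := (h.memLp_diff θ).integrable_sq
  have i2 : Integrable (fun p => (N (rot n θ p) - N (rot n (2 * θ) p)) ^ 2)
      ((gam n).prod (gam n)) :=
    ((h.memLp_comp (rot n θ)).sub (h.memLp_comp (rot n (2 * θ)))).integrable_sq
  calc Dsp N (2 * θ) ≤ ∫ p, (2 * (N p.1 - N (rot n θ p)) ^ 2 +
        2 * (N (rot n θ p) - N (rot n (2 * θ) p)) ^ 2) ∂(gam n).prod (gam n) := by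
        refine integral_mono (h.memLp_diff (2 * θ)).integrable_sq
          ((i1.const_mul 2).add (i2.const_mul 2)) fun p => ?_
        simp only
        nlinarith [sq_nonneg ((N p.1 - N (rot n θ p)) - (N (rot n θ p) - N (rot n (2 * θ) p)))]
    _ = 2 * Dsp N θ + 2 * Dsp N θ := by
        rw [integral_add (i1.const_mul 2) (i2.const_mul 2), integral_const_mul,
          integral_const_mul, ← e1]
        rfl
    _ = _ := by ring

lemma dsp_pow (h : IsNm N) (θ : ℝ) (k : ℕ) : Dsp N θ ≤ 4 ^ k * Dsp N (θ / 2 ^ k) := by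
  induction k with
  | zero => simp
  | succ k ih =>
    have := h.dsp_double (θ / 2 ^ (k + 1))
    have e : 2 * (θ / 2 ^ (k + 1)) = θ / 2 ^ k := by field_simp; ring
    rw [e] at this
    calc _ ≤ _ := ih
      _ ≤ 4 ^ k * (4 * Dsp N (θ / 2 ^ (k + 1))) := by gcongr
      _ = _ := by ring

lemma pos_part_le (h : IsNm N) (hn : 0 < n) (θ : ℝ) :
    ∫ p, (max (N p.1 - N (rot n θ p)) 0) ^ 2 ∂(gam n).prod (gam n) ≤
      (1 - Real.cos θ) ^ 2 * ∫ x, N x ^ 2 ∂gam n + Real.sin θ ^ 2 * sphereMax N ^ 2 := by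
  have hint : Integrable (fun p => (max (N p.1 - N (rot n θ p)) 0) ^ 2)
      ((gam n).prod (gam n)) := by
    have := h.cont
    refine (h.memLp_diff θ).integrable_sq.mono (by fun_prop) (Eventually.of_forall fun p => ?_)
    rw [Real.norm_of_nonneg (by positivity), Real.norm_of_nonneg (by positivity)]
    rcases le_total (N p.1 - N (rot n θ p)) 0 with h0 | h0
    · rw [max_eq_right h0, zero_pow two_ne_zero]; positivity
    · rw [max_eq_left h0]
  rw [integral_prod _ hint]
  have i0 := h.memLp.integrable_sq
  have i1 : Integrable (fun x => (1 - Real.cos θ) ^ 2 * N x ^ 2 +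
      Real.sin θ ^ 2 * sphereMax N ^ 2) (gam n) := (i0.const_mul _).add (integrable_const _)
  calc _ ≤ ∫ x, ((1 - Real.cos θ) ^ 2 * N x ^ 2 + Real.sin θ ^ 2 * sphereMax N ^ 2) ∂gam n := by
        refine integral_mono_of_nonneg
          (Eventually.of_forall fun x => integral_nonneg fun y => by positivity) i1
          (Eventually.of_forall fun x => ?_)
        obtain ⟨L, hL1, hL2⟩ := h.supp x
        have hL : MemLp L 2 (gam n) := IsGaussian.memLp_dual _ L 2 (by simp)
        have iL := hL.integrable_sq
        have iL1 := IsGaussian.integrable_dual (gam n) L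
        set a := (1 - Real.cos θ) * N x
        set s := Real.sin θ
        have i2 : Integrable (fun y => a ^ 2 + (-(2 * a * s)) * L y) (gam n) :=
          (integrable_const _).add (iL1.const_mul _)
        have i3 : Integrable (fun y => (a ^ 2 + (-(2 * a * s)) * L y) + s ^ 2 * L y ^ 2) (gam n) :=
          i2.add (iL.const_mul _)
        have hv : ∫ y, L y ^ 2 ∂gam n = ‖L‖ ^ 2 := by
          rw [← variance_dual_stdGaussian L,
            variance_of_integral_eq_zero L.continuous.aemeasurable
              (integral_strongDual_stdGaussian L)]
        calc ∫ y, (max (N x - N (rot n θ (x, y))) 0) ^ 2 ∂gam n ≤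
            ∫ y, ((a ^ 2 + (-(2 * a * s)) * L y) + s ^ 2 * L y ^ 2) ∂gam n := by
              refine integral_mono_of_nonneg (Eventually.of_forall fun y => by positivity) i3
                (Eventually.of_forall fun y => ?_)
              have h1 : N x - N (rot n θ (x, y)) ≤ a - s * L y := by
                have := hL2 (rot n θ (x, y))
                simp only [rot_apply, map_add, map_smul, smul_eq_mul, hL1] at this ⊢
                simp only [a, s]
                linarith
              have h2 : (max (N x - N (rot n θ (x, y))) 0) ^ 2 ≤ (a - s * L y) ^ 2 := by
                rcases le_total (N x - N (rot n θ (x, y))) 0 with h0 | h0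
                · rw [max_eq_right h0, zero_pow two_ne_zero]; positivity
                · rw [max_eq_left h0]
                  exact pow_le_pow_left₀ h0 h1 2
              simp only
              linarith
          _ = a ^ 2 + s ^ 2 * ‖L‖ ^ 2 := by
              rw [integral_add i2 (iL.const_mul _), integral_add (integrable_const _)
                (iL1.const_mul _), integral_const_mul, integral_const_mul, hv,
                integral_strongDual_stdGaussian L]
              simp
          _ ≤ _ := by
              simp only [a, mul_pow]
              gcongr
              exact h.norm_supp_le hn hL2
    _ = _ := by
        rw [integral_add (i0.const_mul _) (integrable_const _), integral_const_mul]
        simp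

lemma dsp_le (h : IsNm N) (hn : 0 < n) (θ : ℝ) : Dsp N θ ≤
      2 * ((1 - Real.cos θ) ^ 2 * ∫ x, N x ^ 2 ∂gam n + Real.sin θ ^ 2 * sphereMax N ^ 2) := by
  have hc := h.cont
  have hint : ∀ θ, Integrable (fun p => (max (N p.1 - N (rot n θ p)) 0) ^ 2)
      ((gam n).prod (gam n)) := by
    intro θ
    refine (h.memLp_diff θ).integrable_sq.mono (by fun_prop) (Eventually.of_forall fun p => ?_)
    rw [Real.norm_of_nonneg (by positivity), Real.norm_of_nonneg (by positivity)]
    rcases le_total (N p.1 - N (rot n θ p)) 0 with h0 | h0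
    · rw [max_eq_right h0, zero_pow two_ne_zero]; positivity
    · rw [max_eq_left h0]
  have hint2 : Integrable (fun p => (max (N (rot n θ p) - N p.1) 0) ^ 2)
      ((gam n).prod (gam n)) := by
    refine (h.memLp_diff θ).integrable_sq.mono (by fun_prop) (Eventually.of_forall fun p => ?_)
    rw [Real.norm_of_nonneg (by positivity), Real.norm_of_nonneg (by positivity)]
    rcases le_total (N (rot n θ p) - N p.1) 0 with h0 | h0
    · rw [max_eq_right h0, zero_pow two_ne_zero]; positivity
    · rw [max_eq_left h0]; exact le_of_eq (by ring)
  have e : Dsp N θ = ∫ p, (max (N p.1 - N (rot n θ p)) 0) ^ 2 ∂(gam n).prod (gam n) +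
      ∫ p, (max (N (rot n θ p) - N p.1) 0) ^ 2 ∂(gam n).prod (gam n) := by
    rw [← integral_add (hint θ) hint2]
    unfold Dsp
    refine integral_congr_ae (Eventually.of_forall fun p => ?_)
    simp only
    rcases le_total (N (rot n θ p)) (N p.1) with h0 | h0
    · rw [max_eq_left (by linarith), max_eq_right (by linarith)]; ring
    · rw [max_eq_right (by linarith), max_eq_left (by linarith)]; ring
  have e2 : ∫ p, (max (N (rot n θ p) - N p.1) 0) ^ 2 ∂(gam n).prod (gam n) =
      ∫ p, (max (N p.1 - N (rot n (-θ) p)) 0) ^ 2 ∂(gam n).prod (gam n) := by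
    rw [← integral_rot n θ (f := fun p => (max (N p.1 - N (rot n (-θ) p)) 0) ^ 2) (by fun_prop)]
    simp only [rot_rotation, rot_fst]
    simp [rot_apply n 0]
  have b1 := h.pos_part_le hn θ
  have b2 := h.pos_part_le hn (-θ)
  rw [Real.cos_neg, Real.sin_neg, neg_sq] at b2
  rw [e, e2]
  linarith

lemma dsp_pi (h : IsNm N) : Dsp N (π / 2) = 2 * variance N (gam n) := by
  have hi := (h.memLp_diff (π / 2)).integrable_sq
  have i0 := h.memLp.integrable_sq
  have i1 := h.memLp.integrable one_le_two
  unfold Dsp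
  rw [integral_prod _ hi, variance_eq_sub h.memLp]
  simp only [rot_apply, Real.cos_pi_div_two, Real.sin_pi_div_two, zero_smul, one_smul, zero_add]
  set m := ∫ x, N x ∂gam n
  have e1 : ∀ x, ∫ y, (N x - N y) ^ 2 ∂gam n =
      (N x ^ 2 + (-(2 * m)) * N x) + ∫ y, N y ^ 2 ∂gam n := by
    intro x
    have : ∀ y, (N x - N y) ^ 2 = (N x ^ 2 + (-(2 * N x)) * N y) + N y ^ 2 := fun y => by ring
    simp_rw [this]
    have i2 : Integrable (fun y => N x ^ 2 + (-(2 * N x)) * N y) (gam n) :=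
      (integrable_const _).add (i1.const_mul _)
    rw [integral_add i2 i0,
      integral_add (integrable_const _) (i1.const_mul _), integral_const_mul]
    simp only [integral_const, probReal_univ, one_smul]
    ring
  simp_rw [e1]
  have i2 : Integrable (fun x => N x ^ 2 + (-(2 * m)) * N x) (gam n) :=
    i0.add (i1.const_mul _)
  rw [integral_add i2 (integrable_const _),
      integral_add i0 (i1.const_mul _), integral_const_mul]
  simp only [integral_const, probReal_univ, one_smul, Pi.pow_apply]
  ring

/-- Gaussian Poincare inequality for norms. -/
lemma poincare (h : IsNm N) (hn : 0 < n) : variance N (gam n) ≤ (π / 2) ^ 2 * sphereMax N ^ 2 := by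
  set V := ∫ x, N x ^ 2 ∂gam n
  have hV : 0 ≤ V := integral_nonneg fun x => by positivity
  have hk : ∀ k : ℕ, variance N (gam n) ≤
      (π / 2) ^ 2 * ((π / 2 / 2 ^ k) ^ 2 * (V / 4) + sphereMax N ^ 2) := by
    intro k
    have h1 := h.dsp_pow (π / 2) k
    rw [h.dsp_pi] at h1
    set δ := π / 2 / 2 ^ k with hδ
    have h2 := h.dsp_le hn δ
    have hδ0 : 0 ≤ δ := by positivity
    have c1 : (1 - Real.cos δ) ^ 2 ≤ (δ ^ 2 / 2) ^ 2 := by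
      apply pow_le_pow_left₀
      · linarith [Real.cos_le_one δ]
      · linarith [Real.one_sub_sq_div_two_le_cos (x := δ)]
    have c2 : Real.sin δ ^ 2 ≤ δ ^ 2 := Real.sin_sq_le_sq
    have h3 : Dsp N δ ≤ 2 * ((δ ^ 2 / 2) ^ 2 * V + δ ^ 2 * sphereMax N ^ 2) := by
      refine h2.trans ?_
      gcongr
    have h4 : (4 : ℝ) ^ k * δ ^ 2 = (π / 2) ^ 2 := by
      have : (4 : ℝ) ^ k = (2 ^ k) ^ 2 := by rw [← pow_mul, mul_comm, pow_mul]; norm_num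
      rw [this, hδ]
      field_simp
    have h5 : 2 * variance N (gam n) ≤
        4 ^ k * (2 * ((δ ^ 2 / 2) ^ 2 * V + δ ^ 2 * sphereMax N ^ 2)) :=
      h1.trans (by gcongr)
    rw [← h4]
    nlinarith
  have ht : Tendsto (fun k : ℕ => (π / 2) ^ 2 * ((π / 2 / 2 ^ k) ^ 2 * (V / 4) + sphereMax N ^ 2))
      atTop (𝓝 ((π / 2) ^ 2 * (0 ^ 2 * (V / 4) + sphereMax N ^ 2))) := by
    have : Tendsto (fun k : ℕ => π / 2 / (2 : ℝ) ^ k) atTop (𝓝 0) :=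
      tendsto_const_nhds.div_atTop (tendsto_pow_atTop_atTop_of_one_lt one_lt_two)
    exact (((this.pow 2).mul_const _).add_const _).const_mul _
  have := ge_of_tendsto' ht hk
  simpa using this

end IsNm

/-- First absolute moment of a standard Gaussian variable. -/
noncomputable def m1 : ℝ := ∫ x, |x| ∂gaussianReal 0 1

lemma m1_pos : 0 < m1 := by
  have hi : Integrable (fun x : ℝ => |x|) (gaussianReal 0 1) :=
    (IsGaussian.integrable_id (μ := gaussianReal 0 1)).abs
  unfold m1
  rw [integral_pos_iff_support_of_nonneg (fun x => abs_nonneg x) hi]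
  have : Function.support (fun x : ℝ => |x|) = {0}ᶜ := by
    ext x; simp
  have hna : NullSingletonClass (gaussianReal 0 1) := nullSingletonClass_gaussianReal (by norm_num)
  rw [this, prob_compl_eq_one_sub (measurableSet_singleton 0), measure_singleton]
  simp

lemma map_unit {n : ℕ} {U : StrongDual ℝ (Eu n)} (hU : ‖U‖ = 1) :
    (gam n).map U = gaussianReal 0 1 := by
  rw [IsGaussian.map_eq_gaussianReal, integral_strongDual_stdGaussian, variance_dual_stdGaussian,
    hU]
  simp

lemma integral_abs_unit {n : ℕ} {U : StrongDual ℝ (Eu n)} (hU : ‖U‖ = 1) :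
    ∫ x, |U x| ∂gam n = m1 := by
  unfold m1
  rw [← map_unit hU, integral_map U.continuous.aemeasurable (by fun_prop)]

/-- Coordinate functional. -/
noncomputable def crd {n : ℕ} (i : Fin n) : StrongDual ℝ (Eu n) :=
  innerSL ℝ (EuclideanSpace.basisFun (Fin n) ℝ i)

lemma crd_apply {n : ℕ} (i : Fin n) (x : Eu n) : crd i x = x i := by
  simp [crd, EuclideanSpace.inner_single_left]

lemma crd_norm {n : ℕ} (i : Fin n) : ‖(crd i : StrongDual ℝ (Eu n))‖ = 1 := by
  simp [crd]

lemma normLp (n : ℕ) : MemLp (fun x : Eu n => ‖x‖) 2 (gam n) :=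
  (IsGaussian.memLp_two_id (μ := gam n)).norm

lemma en_upper (n : ℕ) : (∫ x, ‖x‖ ∂gam n) ^ 2 ≤ n := by
  have h0 := variance_nonneg (fun x : Eu n => ‖x‖) (gam n)
  rw [variance_eq_sub (normLp n)] at h0
  have : ∫ x : Eu n, ((fun x => ‖x‖) ^ 2) x ∂gam n = n := by
    simp only [Pi.pow_apply, EuclideanSpace.norm_sq_eq, Real.norm_eq_abs, sq_abs]
    rw [integral_finsetSum]
    · have : ∀ i : Fin n, ∫ x : Eu n, x i ^ 2 ∂gam n = 1 := by
        intro i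
        have := variance_dual_stdGaussian (crd i : StrongDual ℝ (Eu n))
        rw [variance_of_integral_eq_zero (crd i).continuous.aemeasurable
              (integral_strongDual_stdGaussian _), crd_norm] at this
        simpa [crd_apply] using this
      simp [this]
    · intro i _
      have := (IsGaussian.memLp_dual (gam n) (crd i) 2 (by simp)).integrable_sq
      simpa [crd_apply] using this
  rw [this] at h0
  linarith

lemma en_lower (n : ℕ) : m1 * √n ≤ ∫ x, ‖x‖ ∂gam n := by
  rcases Nat.eq_zero_or_pos n with hn | hn
  · subst hn
    simp only [CharP.cast_eq_zero, Real.sqrt_zero, mul_zero]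
    exact integral_nonneg fun x => norm_nonneg _
  have hn' : (0 : ℝ) < n := by exact_mod_cast hn
  have hi : ∀ i : Fin n, Integrable (fun x : Eu n => |x i|) (gam n) := by
    intro i
    have := (IsGaussian.integrable_dual (gam n) (crd i)).abs
    simpa [crd_apply] using this
  have h1 : ∫ x : Eu n, ∑ i, |x i| ∂gam n = n * m1 := by
    rw [integral_finsetSum _ (fun i _ => hi i)]
    have : ∀ i : Fin n, ∫ x : Eu n, |x i| ∂gam n = m1 := by
      intro i
      have := integral_abs_unit (crd_norm i)
      simpa [crd_apply] using this
    simp [this]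
  have h2 : ∫ x : Eu n, ∑ i, |x i| ∂gam n ≤ ∫ x : Eu n, √n * ‖x‖ ∂gam n := by
    refine integral_mono (integrable_finsetSum _ fun i _ => hi i)
      (((normLp n).integrable one_le_two).const_mul _) fun x => ?_
    simp only
    rw [EuclideanSpace.norm_eq, ← Real.sqrt_mul hn'.le]
    apply Real.le_sqrt_of_sq_le
    have := sq_sum_le_card_mul_sum_sq (s := Finset.univ) (f := fun i => |x i|)
    simpa using this
  rw [h1, integral_const_mul] at h2
  have h3 : (√n) * √n = n := Real.mul_self_sqrt hn'.le
  have h4 : 0 < √(n : ℝ) := Real.sqrt_pos.2 hn'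
  have h5 : √(n : ℝ) * (m1 * √n) ≤ √n * ∫ x, ‖x‖ ∂gam n := by
    calc √(n : ℝ) * (m1 * √n) = (√n * √n) * m1 := by ring
      _ = n * m1 := by rw [h3]
      _ ≤ _ := h2
  exact le_of_mul_le_mul_left h5 h4

lemma tail (t : ℝ) (ht : 0 ≤ t) : ENNReal.ofReal (gaussianPDFReal 0 1 (t + 1)) ≤
    gaussianReal 0 1 (Ici t) := by
  calc ENNReal.ofReal (gaussianPDFReal 0 1 (t + 1))
      = ∫⁻ x in Icc t (t + 1), ENNReal.ofReal (gaussianPDFReal 0 1 (t + 1)) := by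
        simp
    _ ≤ ∫⁻ x in Icc t (t + 1), gaussianPDF 0 1 x := by
        refine setLIntegral_mono (measurable_gaussianPDF 0 1) fun x hx => ?_
        apply ENNReal.ofReal_le_ofReal
        unfold gaussianPDFReal
        have h1 := hx.1
        have h2 := hx.2
        have h3 : x ^ 2 ≤ (t + 1) ^ 2 := pow_le_pow_left₀ (ht.trans h1) h2 2
        apply mul_le_mul_of_nonneg_left _ (by positivity)
        apply Real.exp_le_exp.2
        simp only [sub_zero, NNReal.coe_one]
        linarith
    _ = gaussianReal 0 1 (Icc t (t + 1)) := by rw [gaussianReal_apply _ (by norm_num)]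
    _ ≤ _ := measure_mono Icc_subset_Ici_self

namespace IsNm

variable {n : ℕ} {N : Eu n → ℝ}

lemma exists_unit (h : IsNm N) (hn : 0 < n) : 0 < sphereMax N ∧ ∃ U : StrongDual ℝ (Eu n), ‖U‖ = 1 ∧
    ∀ x, sphereMax N * |U x| ≤ N x := by
  obtain ⟨θ, hθ1, hθ2, hb⟩ := h.exists_max hn
  have hbpos : 0 < sphereMax N := by
    rw [hθ2]
    exact h.pos θ (fun h0 => by rw [h0, norm_zero] at hθ1; exact zero_ne_one hθ1)
  obtain ⟨L, hL1, hL2⟩ := h.supp θ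
  have hLn : ‖L‖ = sphereMax N := by
    apply le_antisymm (h.norm_supp_le hn hL2)
    have := L.le_opNorm θ
    rw [hθ1, mul_one, hL1, ← hθ2] at this
    exact (le_abs_self _).trans this
  refine ⟨hbpos, (sphereMax N)⁻¹ • L, ?_, fun x => ?_⟩
  · rw [norm_smul, norm_inv, hLn, Real.norm_of_nonneg hbpos.le]
    field_simp
  · have := h.abs_le_of_supp hL2 x
    have e1 : sphereMax N * |((sphereMax N)⁻¹ • L) x| = |L x| := by
      rw [FunLike.coe_smul, Pi.smul_apply, smul_eq_mul, abs_mul, abs_inv,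
        abs_of_pos hbpos]
      field_simp
    rw [e1]; exact this

lemma beta_lower (h : IsNm N) {U : StrongDual ℝ (Eu n)} (hU : ‖U‖ = 1) {b A : ℝ} (hb : 0 < b)
    (hUN : ∀ x, b * |U x| ≤ N x) (hA : ∫ x, N x ∂gam n = A) (hApos : 0 < A) :
    gaussianPDFReal 0 1 (2 * A / b + 1) ≤ variance N (gam n) / A ^ 2 := by
  have hc := meas_ge_le_variance_div_sq h.memLp hApos
  rw [hA] at hc
  have hsub : gaussianReal 0 1 (Ici (2 * A / b)) ≤ ENNReal.ofReal (variance N (gam n) / A ^ 2) := by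
    refine le_trans ?_ hc
    rw [← map_unit hU, Measure.map_apply U.continuous.measurable measurableSet_Ici]
    refine measure_mono fun x hx => ?_
    have hx' : 2 * A / b ≤ U x := hx
    have h1 : 2 * A ≤ N x := by
      refine le_trans ?_ (hUN x)
      calc 2 * A = b * (2 * A / b) := by field_simp
        _ ≤ b * |U x| := by gcongr; exact hx'.trans (le_abs_self _)
    change A ≤ |N x - A|
    exact le_trans (by linarith) (le_abs_self _)
  have hb0 : 0 ≤ variance N (gam n) / A ^ 2 := div_nonneg (variance_nonneg _ _) (by positivity)
  exact (ENNReal.ofReal_le_ofReal_iff hb0).1 ((tail _ (by positivity)).trans hsub)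

lemma final (h : IsNm N) (hn : 0 < n) :
    (1 / (4 + 3 / m1 ^ 2)) * Real.log (1 / gaussBeta N) ≤ dvoretzkyDim N ∧
      dvoretzkyDim N ≤ ((π / 2) ^ 2 / m1 ^ 2) / gaussBeta N := by
  have hm := m1_pos
  have hn' : (0 : ℝ) < n := by exact_mod_cast hn
  obtain ⟨hbpos, U, hU, hUN⟩ := h.exists_unit hn
  have hP := h.poincare hn
  have hpol := polar' n hn N h.hom
  have hβ : gaussBeta N = variance N (gam n) / (∫ x, N x ∂gam n) ^ 2 := by
    unfold gaussBeta
    rw [std_eq]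
  unfold dvoretzkyDim
  set b := sphereMax N
  set M := sphereMean N
  set β := gaussBeta N
  set A := ∫ x, N x ∂gam n
  set V := variance N (gam n)
  have he1 := en_upper n
  have he2 := en_lower n
  set e := ∫ x, ‖x‖ ∂gam n
  have hsn : 0 < √(n : ℝ) := Real.sqrt_pos.2 hn'
  have he0 : 0 < e := lt_of_lt_of_le (by positivity) he2
  have he3 : m1 ^ 2 * n ≤ e ^ 2 := by
    have := pow_le_pow_left₀ (by positivity) he2 2
    rwa [mul_pow, Real.sq_sqrt hn'.le] at this
  have iN := h.memLp.integrable one_le_two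
  have hA : b * m1 ≤ A := by
    rw [← integral_abs_unit hU, ← integral_const_mul]
    exact integral_mono ((IsGaussian.integrable_dual (gam n) U).abs.const_mul b) iN hUN
  have hApos : 0 < A := lt_of_lt_of_le (by positivity) hA
  have hM : M = A / e := by rw [hpol]; field_simp
  have hk1 : (A / b) ^ 2 ≤ n * (M / b) ^ 2 := by
    rw [hM]
    have : (n : ℝ) * (A / e / b) ^ 2 = (A / b) ^ 2 * (n / e ^ 2) := by field_simp
    rw [this]
    apply le_mul_of_one_le_right (by positivity)
    rwa [one_le_div (by positivity)]
  have hkm : m1 ^ 2 ≤ n * (M / b) ^ 2 := by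
    refine le_trans ?_ hk1
    apply pow_le_pow_left₀ hm.le
    rw [le_div_iff₀ hbpos]; linarith
  set t := 2 * A / b
  have ht : 0 ≤ t := by positivity
  have hβ1 : gaussianPDFReal 0 1 (t + 1) ≤ β := by
    rw [hβ]
    exact h.beta_lower hU hbpos hUN rfl hApos
  have hφ : 0 < gaussianPDFReal 0 1 (t + 1) := gaussianPDFReal_pos _ _ _ (by norm_num)
  have hβ0 : 0 < β := hφ.trans_le hβ1
  constructor
  · have hl : Real.log (1 / β) ≤ 4 * (n * (M / b) ^ 2) + 3 := by
      have h1 : -Real.log β ≤ -Real.log (gaussianPDFReal 0 1 (t + 1)) :=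
        neg_le_neg (Real.log_le_log hφ hβ1)
      have h2 : Real.log (gaussianPDFReal 0 1 (t + 1)) = -Real.log (√(2 * π)) - (t + 1) ^ 2 / 2 := by
        unfold gaussianPDFReal
        rw [Real.log_mul (by positivity) (by positivity), Real.log_exp, Real.log_inv]
        simp
        ring
      have h3 : Real.log (√(2 * π)) ≤ 2 := by
        have h4 : √(2 * π) ≤ 3 := by
          rw [Real.sqrt_le_left (by norm_num)]
          linarith [Real.pi_lt_four]
        have := Real.log_le_sub_one_of_pos (x := √(2 * π)) (by positivity)
        linarith
      have h5 : t ^ 2 ≤ 4 * (n * (M / b) ^ 2) := by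
        have : t ^ 2 = 4 * (A / b) ^ 2 := by simp only [t]; ring
        rw [this]
        linarith
      rw [one_div, Real.log_inv]
      nlinarith [sq_nonneg (t - 1)]
    have h6 : 4 * (n * (M / b) ^ 2) + 3 ≤ (4 + 3 / m1 ^ 2) * (n * (M / b) ^ 2) := by
      have : 3 ≤ 3 / m1 ^ 2 * (n * (M / b) ^ 2) := by
        rw [div_mul_eq_mul_div, le_div_iff₀ (by positivity)]
        linarith
      linarith
    rw [one_div, inv_mul_le_iff₀ (by positivity)]
    exact hl.trans h6
  · rw [le_div_iff₀ hβ0, hβ, hM, le_div_iff₀ (by positivity)]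
    have : (n : ℝ) * (A / e / b) ^ 2 * (V / A ^ 2) * m1 ^ 2 = (V / b ^ 2) * ((m1 ^ 2 * n) / e ^ 2) := by
      field_simp
    rw [this]
    have h1 : V / b ^ 2 ≤ (π / 2) ^ 2 := by rwa [div_le_iff₀ (by positivity)]
    have h2 : (m1 ^ 2 * n) / e ^ 2 ≤ 1 := by rwa [div_le_one (by positivity)]
    calc _ ≤ (π / 2) ^ 2 * 1 := by gcongr
      _ = _ := mul_one _

end IsNm

end DvProof

/-- There are absolute constants `c, C > 0` with
`c·log(1/β(X)) ≤ k(X) ≤ C/β(X)` for every finite-dimensional normed space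
`X = (ℝⁿ, ‖·‖)`. -/
theorem dvoretzky_dim_vs_beta :
    ∃ c C : ℝ, 0 < c ∧ 0 < C ∧
      ∀ (n : ℕ), 0 < n →
      ∀ N : EuclideanSpace ℝ (Fin n) → ℝ,
        (∀ x, x ≠ 0 → 0 < N x) →
        (∀ (a : ℝ) (x), N (a • x) = |a| * N x) →
        (∀ x y, N (x + y) ≤ N x + N y) →
        c * Real.log (1 / gaussBeta N) ≤ dvoretzkyDim N ∧
        dvoretzkyDim N ≤ C / gaussBeta N := by
  have hm := DvProof.m1_pos
  refine ⟨1 / (4 + 3 / DvProof.m1 ^ 2), (π / 2) ^ 2 / DvProof.m1 ^ 2, by positivity,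
    by positivity, ?_⟩
  intro n hn N h1 h2 h3
  exact (DvProof.IsNm.mk h1 h2 h3 : DvProof.IsNm N).final hn
end

section
/- Define f : ℝ^{n+1} → ℝ by f(t,x) = |t| + ‖x‖_∞ for (t,x) ∈ ℝ × ℝⁿ. There exist absolute constants c, C > 0 such that for all sufficiently large n and all r ≥ 1: c√r ≤ (E|f(g₁, Z₁) − f(g₂, Z₂)|^r)^{1/r} ≤ C√r, where g₁, g₂ are i.i.d. standard normal random variables and Z₁, Z₂ are independent standard Gaussian random vectors on ℝⁿ, all mutually independent. -/
open MeasureTheory ProbabilityTheory Real Set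

/-- The law of `(g, Z)` where `g` is a standard normal random variable and `Z` is an
independent standard Gaussian random vector on `ℝⁿ`; i.e. the standard Gaussian measure on
`ℝ^{n+1} = ℝ × ℝⁿ`. The norm on `Fin n → ℝ` is the supremum norm `‖·‖_∞`. -/
noncomputable def gaussPair (n : ℕ) : Measure (ℝ × (Fin n → ℝ)) :=
  (gaussianReal 0 1).prod (Measure.pi fun _ : Fin n => gaussianReal 0 1)

/-- `f(t,x) = |t| + ‖x‖_∞` on `ℝ^{n+1} = ℝ × ℝⁿ`. -/
noncomputable def fPerturb {n : ℕ} (p : ℝ × (Fin n → ℝ)) : ℝ :=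
  |p.1| + ‖p.2‖

open scoped ENNReal

/-- one-sided Gaussian tail `P(g > m)`. -/
lemma gauss_tail_one (m s : ℝ) (hm : 0 ≤ m) (hs : 0 ≤ s) :
    gaussianReal 0 1 (Ioi (m + s)) ≤ ENNReal.ofReal (exp (-s ^ 2 / 2)) * gaussianReal 0 1 (Ioi m) := by
  have h1 : gaussianReal 0 1 (Ioi (m + s)) = gaussianReal (-s) 1 (Ioi m) := by
    have := gaussianReal_map_add_const (μ := 0) (v := 1) (-s)
    rw [zero_add] at this
    rw [← this, Measure.map_apply (by fun_prop) measurableSet_Ioi]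
    congr 1
    ext x
    simp only [mem_Ioi, mem_preimage]
    constructor <;> intro h <;> linarith
  rw [h1, gaussianReal_apply _ one_ne_zero, gaussianReal_apply _ one_ne_zero,
    ← lintegral_const_mul _ (measurable_gaussianPDF 0 1)]
  refine setLIntegral_mono ((measurable_gaussianPDF 0 1).const_mul _) fun x hx => ?_
  have hx' : 0 ≤ x := hm.trans (le_of_lt hx)
  rw [gaussianPDF, gaussianPDF, ← ENNReal.ofReal_mul (exp_pos _).le]
  apply ENNReal.ofReal_le_ofReal
  simp only [gaussianPDFReal]
  rw [mul_left_comm, ← Real.exp_add]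
  refine mul_le_mul_of_nonneg_left ?_ (by positivity)
  apply Real.exp_le_exp.mpr
  simp only [NNReal.coe_one]
  nlinarith [mul_nonneg hx' hs]

lemma gauss_abs_tail_eq (m : ℝ) (hm : 0 ≤ m) :
    gaussianReal 0 1 {t : ℝ | m < |t|} = 2 * gaussianReal 0 1 (Ioi m) := by
  have hset : {t : ℝ | m < |t|} = Ioi m ∪ (fun x : ℝ => -x) ⁻¹' (Ioi m) := by
    ext t; simp only [lt_abs, mem_union, mem_preimage, mem_Ioi, mem_ofPred_eq]
  have hd : Disjoint (Ioi m) ((fun x : ℝ => -x) ⁻¹' (Ioi m)) := by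
    rw [Set.disjoint_left]
    intro t h1 h2
    simp only [mem_Ioi, mem_preimage] at h1 h2
    linarith
  rw [hset, measure_union hd ((measurable_neg) measurableSet_Ioi),
    ← Measure.map_apply (by fun_prop) measurableSet_Ioi, gaussianReal_map_neg, neg_zero, two_mul]

lemma gauss_abs_tail (m s : ℝ) (hm : 0 ≤ m) (hs : 0 ≤ s) :
    gaussianReal 0 1 {t : ℝ | m + s < |t|} ≤
      ENNReal.ofReal (exp (-s ^ 2 / 2)) * gaussianReal 0 1 {t : ℝ | m < |t|} := by
  rw [gauss_abs_tail_eq _ hm, gauss_abs_tail_eq _ (add_nonneg hm hs), mul_left_comm]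
  gcongr
  exact gauss_tail_one m s hm hs

/-- The mean of `n * P(|g| > M)` is at most one. -/
lemma mean_tail_max (n : ℕ) :
    (n : ℝ≥0∞) * ∫⁻ y, gaussianReal 0 1 {t : ℝ | ‖y‖ < |t|}
      ∂(Measure.pi fun _ : Fin n => gaussianReal 0 1) ≤ 1 := by
  set E : Set (ℝ × (Fin n → ℝ)) := {p | ‖p.2‖ < |p.1|} with hE
  have hEm : MeasurableSet E :=
    measurableSet_lt (by fun_prop) (by fun_prop)
  have h1 : ∫⁻ y, gaussianReal 0 1 {t : ℝ | ‖y‖ < |t|}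
      ∂(Measure.pi fun _ : Fin n => gaussianReal 0 1)
      = ((gaussianReal 0 1).prod (Measure.pi fun _ : Fin n => gaussianReal 0 1)) E := by
    rw [Measure.prod_apply_symm hEm]; rfl
  rw [h1]
  set P := Measure.pi fun _ : Fin (n+1) => gaussianReal 0 1 with hP
  let A : Fin (n+1) → Set (Fin (n+1) → ℝ) := fun i =>
    (MeasurableEquiv.piFinSuccAbove (fun _ => ℝ) i) ⁻¹' E
  have hA : ∀ i, P (A i) =
      ((gaussianReal 0 1).prod (Measure.pi fun _ : Fin n => gaussianReal 0 1)) E := fun i =>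
    (measurePreserving_piFinSuccAbove (fun _ : Fin (n+1) => gaussianReal 0 1) i).measure_preimage
      hEm.nullMeasurableSet
  have hAm : ∀ i, MeasurableSet (A i) := fun i => (MeasurableEquiv.measurable _) hEm
  have key : ∀ i j x, x ∈ A i → i ≠ j → |x j| < |x i| := by
    intro i j x hx hij
    obtain ⟨k, rfl⟩ := Fin.exists_succAbove_eq hij.symm
    have : ‖fun l => x (i.succAbove l)‖ < |x i| := hx
    exact lt_of_le_of_lt (norm_le_pi_norm (fun l => x (i.succAbove l)) k) this
  have hdis : Pairwise (Function.onFun Disjoint A) := by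
    intro i j hij
    rw [Function.onFun, Set.disjoint_left]
    intro x hi hj
    exact lt_asymm (key i j x hi hij) (key j i x hj hij.symm)
  have h2 : P (⋃ i, A i) ≤ 1 := prob_le_one
  rw [measure_iUnion hdis hAm, tsum_fintype] at h2
  simp only [hA, Finset.sum_const, Finset.card_univ, Fintype.card_fin, nsmul_eq_mul] at h2
  refine le_trans ?_ h2
  gcongr
  simp

lemma max_tail (n : ℕ) (s : ℝ) (hs : 0 ≤ s) :
    ((Measure.pi fun _ : Fin n => gaussianReal 0 1).prod
      (Measure.pi fun _ : Fin n => gaussianReal 0 1)) {q | ‖q.1‖ + s < ‖q.2‖} ≤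
      ENNReal.ofReal (exp (-s ^ 2 / 2)) := by
  set P := Measure.pi fun _ : Fin n => gaussianReal 0 1 with hP
  rw [Measure.prod_apply (measurableSet_lt (by fun_prop) (by fun_prop))]
  have h : ∀ y : Fin n → ℝ, P (Prod.mk y ⁻¹' {q : (Fin n → ℝ) × (Fin n → ℝ) | ‖q.1‖ + s < ‖q.2‖}) ≤
      ENNReal.ofReal (exp (-s ^ 2 / 2)) * n * gaussianReal 0 1 {t : ℝ | ‖y‖ < |t|} := by
    intro y
    have hsub : (Prod.mk y ⁻¹' {q : (Fin n → ℝ) × (Fin n → ℝ) | ‖q.1‖ + s < ‖q.2‖}) ⊆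
        ⋃ i, (Function.eval i) ⁻¹' {t : ℝ | ‖y‖ + s < |t|} := by
      intro x hx
      have hx : ‖y‖ + s < ‖x‖ := hx
      by_contra hc
      simp only [mem_iUnion, mem_preimage, mem_ofPred_eq, not_exists, not_lt] at hc
      exact absurd ((pi_norm_le_iff_of_nonneg (by positivity)).mpr hc) (not_le.mpr hx)
    calc _ ≤ P _ := measure_mono hsub
      _ ≤ ∑ i, P ((Function.eval i) ⁻¹' {t : ℝ | ‖y‖ + s < |t|}) := by
        simpa using measure_iUnion_fintype_le P _
      _ = ∑ i : Fin n, gaussianReal 0 1 {t : ℝ | ‖y‖ + s < |t|} := by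
        refine Finset.sum_congr rfl fun i _ => ?_
        exact (measurePreserving_eval (fun _ : Fin n => gaussianReal 0 1) i).measure_preimage
          (measurableSet_lt (by fun_prop) (by fun_prop)).nullMeasurableSet
      _ ≤ _ := by
        simp only [Finset.sum_const, Finset.card_univ, Fintype.card_fin, nsmul_eq_mul]
        rw [mul_comm (ENNReal.ofReal _), mul_assoc]
        gcongr
        exact gauss_abs_tail _ _ (norm_nonneg y) hs
  refine (lintegral_mono h).trans ?_
  have hmeas : Measurable fun y : Fin n → ℝ => gaussianReal 0 1 {t : ℝ | ‖y‖ < |t|} := by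
    have hEm : MeasurableSet {p : (Fin n → ℝ) × ℝ | ‖p.1‖ < |p.2|} :=
      measurableSet_lt (by fun_prop) (by fun_prop)
    exact measurable_measure_prodMk_left hEm
  rw [lintegral_const_mul _ hmeas, mul_assoc]
  calc _ ≤ ENNReal.ofReal (exp (-s ^ 2 / 2)) * 1 := by gcongr; exact mean_tail_max n
    _ = _ := mul_one _

lemma one_tail (s : ℝ) (hs : 0 ≤ s) :
    ((gaussianReal 0 1).prod (gaussianReal 0 1)) {q | |q.1| + s < |q.2|} ≤
      ENNReal.ofReal (exp (-s ^ 2 / 2)) := by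
  rw [Measure.prod_apply (measurableSet_lt (by fun_prop) (by fun_prop))]
  have h : ∀ y : ℝ, gaussianReal 0 1 (Prod.mk y ⁻¹' {q : ℝ × ℝ | |q.1| + s < |q.2|}) ≤
      ENNReal.ofReal (exp (-s ^ 2 / 2)) := by
    intro y
    refine (gauss_abs_tail |y| s (abs_nonneg y) hs).trans ?_
    calc _ ≤ ENNReal.ofReal (exp (-s ^ 2 / 2)) * 1 := by gcongr; exact prob_le_one
      _ = _ := mul_one _
  refine (lintegral_mono h).trans ?_
  simp

instance gaussPair_prob (n : ℕ) : IsProbabilityMeasure (gaussPair n) := by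
  unfold gaussPair; infer_instance

lemma fPerturb_meas (n : ℕ) : Measurable (fPerturb (n := n)) := by
  unfold fPerturb; fun_prop

lemma swap_tail {α : Type*} [MeasurableSpace α] (μ : Measure α) [SFinite μ] (g : α → ℝ)
    (hg : Measurable g) (s : ℝ) :
    (μ.prod μ) {q | g q.2 + s < g q.1} = (μ.prod μ) {q | g q.1 + s < g q.2} :=
  (Measure.measurePreserving_swap (μ := μ) (ν := μ)).measure_preimage (s := {q | g q.1 + s < g q.2})
    (measurableSet_lt (by fun_prop) (by fun_prop)).nullMeasurableSet

lemma diff_tail (n : ℕ) (s : ℝ) (hs : 0 ≤ s) :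
    ((gaussPair n).prod (gaussPair n)) {q | s < |fPerturb q.1 - fPerturb q.2|} ≤
      ENNReal.ofReal (4 * exp (-s ^ 2 / 8)) := by
  set μ := (gaussPair n).prod (gaussPair n) with hμ
  set P := Measure.pi fun _ : Fin n => gaussianReal 0 1 with hP
  have hs2 : 0 ≤ s / 2 := by positivity
  have m1 : MeasurePreserving (Prod.map Prod.fst Prod.fst) μ
      ((gaussianReal 0 1).prod (gaussianReal 0 1)) := by
    have : MeasurePreserving Prod.fst (gaussPair n) (gaussianReal 0 1) := measurePreserving_fst
    exact this.prod this
  have m2 : MeasurePreserving (Prod.map Prod.snd Prod.snd) μ (P.prod P) := by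
    have : MeasurePreserving Prod.snd (gaussPair n) P := measurePreserving_snd
    exact this.prod this
  set e := ENNReal.ofReal (exp (-(s/2) ^ 2 / 2))
  have a1 : μ (Prod.map Prod.fst Prod.fst ⁻¹' {q : ℝ × ℝ | |q.1| + s / 2 < |q.2|}) ≤ e := by
    rw [m1.measure_preimage (measurableSet_lt (by fun_prop) (by fun_prop)).nullMeasurableSet]
    exact one_tail _ hs2
  have a2 : μ (Prod.map Prod.fst Prod.fst ⁻¹' {q : ℝ × ℝ | |q.2| + s / 2 < |q.1|}) ≤ e := by
    rw [m1.measure_preimage (measurableSet_lt (by fun_prop) (by fun_prop)).nullMeasurableSet,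
      swap_tail _ (fun x : ℝ => |x|) (by fun_prop)]
    exact one_tail _ hs2
  have a3 : μ (Prod.map Prod.snd Prod.snd ⁻¹'
      {q : (Fin n → ℝ) × (Fin n → ℝ) | ‖q.1‖ + s / 2 < ‖q.2‖}) ≤ e := by
    rw [m2.measure_preimage (measurableSet_lt (by fun_prop) (by fun_prop)).nullMeasurableSet]
    exact max_tail _ _ hs2
  have a4 : μ (Prod.map Prod.snd Prod.snd ⁻¹'
      {q : (Fin n → ℝ) × (Fin n → ℝ) | ‖q.2‖ + s / 2 < ‖q.1‖}) ≤ e := by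
    rw [m2.measure_preimage (measurableSet_lt (by fun_prop) (by fun_prop)).nullMeasurableSet,
      swap_tail _ (fun x : Fin n → ℝ => ‖x‖) (by fun_prop)]
    exact max_tail _ _ hs2
  have hsub : {q : (ℝ × (Fin n → ℝ)) × (ℝ × (Fin n → ℝ)) | s < |fPerturb q.1 - fPerturb q.2|} ⊆
      ((Prod.map Prod.fst Prod.fst ⁻¹' {q : ℝ × ℝ | |q.1| + s / 2 < |q.2|}) ∪
      (Prod.map Prod.fst Prod.fst ⁻¹' {q : ℝ × ℝ | |q.2| + s / 2 < |q.1|})) ∪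
      ((Prod.map Prod.snd Prod.snd ⁻¹'
        {q : (Fin n → ℝ) × (Fin n → ℝ) | ‖q.1‖ + s / 2 < ‖q.2‖}) ∪
      (Prod.map Prod.snd Prod.snd ⁻¹'
        {q : (Fin n → ℝ) × (Fin n → ℝ) | ‖q.2‖ + s / 2 < ‖q.1‖})) := by
    rintro ⟨⟨t, x⟩, ⟨u, y⟩⟩ hq
    have hq : s < |(|t| + ‖x‖) - (|u| + ‖y‖)| := hq
    by_contra hc
    simp only [mem_union, mem_preimage, mem_ofPred_eq, Prod.map, not_or, not_lt] at hc
    obtain ⟨⟨h1, h2⟩, h3, h4⟩ := hc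
    rcases lt_abs.mp hq with h | h <;> linarith
  refine (measure_mono hsub).trans ?_
  have he : ENNReal.ofReal (4 * exp (-s ^ 2 / 8)) = (e + e) + (e + e) := by
    simp only [e]
    rw [← ENNReal.ofReal_add (by positivity) (by positivity),
      ← ENNReal.ofReal_add (by positivity) (by positivity)]
    congr 1
    rw [show -(s/2)^2/2 = -s^2/8 by ring]
    ring
  rw [he]
  exact (measure_union_le _ _).trans (add_le_add ((measure_union_le _ _).trans (add_le_add a1 a2))
    ((measure_union_le _ _).trans (add_le_add a3 a4)))

lemma pow_bound (r t : ℝ) (hr : 1 ≤ r) (ht : 0 < t) :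
    t ^ (r - 1) ≤ (4 * √r) ^ r * exp (t ^ 2 / 16) := by
  have hr0 : 0 < r := by linarith
  have hsr : 1 ≤ √r := Real.one_le_sqrt.mpr hr
  have hK : 0 < 4 * √r := by positivity
  set u := t / (4 * √r) with hu
  have hu0 : 0 < u := by positivity
  have htu : t = (4 * √r) * u := by rw [hu]; field_simp
  have hu2 : u ^ 2 * r = t ^ 2 / 16 := by
    rw [htu, mul_pow, mul_pow, Real.sq_sqrt hr0.le]; ring
  have h1 : u ≤ exp (u ^ 2) := by
    have := Real.add_one_le_exp (u ^ 2)
    nlinarith [sq_nonneg (u - 1)]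
  have h2 : u ^ (r - 1) ≤ exp (t ^ 2 / 16) := by
    calc u ^ (r-1) ≤ (exp (u ^ 2)) ^ (r - 1) := Real.rpow_le_rpow hu0.le h1 (by linarith)
      _ = exp (u ^ 2 * (r - 1)) := by rw [← Real.exp_mul]
      _ ≤ exp (t ^ 2 / 16) := by
        apply Real.exp_le_exp.mpr; rw [← hu2]; nlinarith [sq_nonneg u]
  have h3 : (4 * √r) ^ (r - 1) ≤ (4 * √r) ^ r :=
    Real.rpow_le_rpow_of_exponent_le (by linarith) (by linarith)
  calc t ^ (r - 1) = (4 * √r) ^ (r - 1) * u ^ (r - 1) := by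
        conv_lhs => rw [htu]
        exact Real.mul_rpow hK.le hu0.le
    _ ≤ _ := by gcongr

lemma upper_lint (n : ℕ) (r : ℝ) (hr : 1 ≤ r) :
    ∫⁻ q, ENNReal.ofReal (|fPerturb q.1 - fPerturb q.2| ^ r) ∂((gaussPair n).prod (gaussPair n)) ≤
      ENNReal.ofReal ((64 * exp 1 * √r) ^ r) := by
  have hr0 : 0 < r := by linarith
  have hm : Measurable fun q : (ℝ × (Fin n → ℝ)) × (ℝ × (Fin n → ℝ)) =>
      |fPerturb q.1 - fPerturb q.2| := by
    have := fPerturb_meas n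
    fun_prop
  rw [lintegral_rpow_eq_lintegral_meas_lt_mul _ (ae_of_all _ fun q => abs_nonneg _)
    hm.aemeasurable hr0]
  have hb : ∀ t ∈ Ioi (0:ℝ), ((gaussPair n).prod (gaussPair n))
      {q | t < |fPerturb q.1 - fPerturb q.2|} * ENNReal.ofReal (t ^ (r - 1)) ≤
      ENNReal.ofReal (4 * (4 * √r) ^ r) * ENNReal.ofReal (exp (-(1/16) * t ^ 2)) := by
    intro t ht
    have ht : 0 < t := ht
    calc _ ≤ ENNReal.ofReal (4 * exp (-t ^ 2 / 8)) * ENNReal.ofReal ((4 * √r) ^ r * exp (t ^ 2 / 16)) := by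
          gcongr
          · exact diff_tail n t ht.le
          · exact pow_bound r t hr ht
      _ = _ := by
        rw [← ENNReal.ofReal_mul (by positivity), ← ENNReal.ofReal_mul (by positivity)]
        congr 1
        rw [show -(1/16) * t ^ 2 = -t^2/8 + t^2/16 by ring, Real.exp_add]
        ring
  have hi : ∫⁻ t in Ioi (0:ℝ), ENNReal.ofReal (exp (-(1/16) * t ^ 2)) ≤ ENNReal.ofReal 4 := by
    rw [← ofReal_integral_eq_lintegral_ofReal
      ((integrable_exp_neg_mul_sq (by norm_num)).integrableOn)
      (ae_of_all _ fun t => (exp_pos _).le), integral_gaussian_Ioi]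
    apply ENNReal.ofReal_le_ofReal
    have : √(π / (1/16)) ≤ 8 := by
      rw [Real.sqrt_le_left (by norm_num)]
      linarith [Real.pi_le_four]
    linarith
  calc _ ≤ ENNReal.ofReal r * ∫⁻ t in Ioi (0:ℝ),
        ENNReal.ofReal (4 * (4 * √r) ^ r) * ENNReal.ofReal (exp (-(1/16) * t ^ 2)) := by
        exact mul_le_mul_right (setLIntegral_mono (by fun_prop) hb) _
    _ ≤ ENNReal.ofReal r * (ENNReal.ofReal (4 * (4 * √r) ^ r) * ENNReal.ofReal 4) := by
        rw [lintegral_const_mul _ (by fun_prop)]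
        gcongr
    _ ≤ _ := by
        rw [← ENNReal.ofReal_mul (by positivity), ← ENNReal.ofReal_mul (by positivity)]
        apply ENNReal.ofReal_le_ofReal
        have h1 : r ≤ (exp 1) ^ r := by
          rw [← Real.exp_mul, one_mul]; linarith [Real.add_one_le_exp r]
        have h2 : (16:ℝ) ≤ 16 ^ r := by
          simpa using Real.rpow_le_rpow_of_exponent_le (x := 16) (by norm_num) hr
        have h3 : (64 * exp 1 * √r) ^ r = (exp 1) ^ r * (16 ^ r * (4 * √r) ^ r) := by
          rw [← Real.mul_rpow (by positivity) (by positivity),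
            ← Real.mul_rpow (by positivity) (by positivity)]
          congr 1; ring
        rw [h3]
        have : r * (4 * (4 * √r) ^ r * 4) = r * (16 * (4 * √r) ^ r) := by ring
        rw [this]
        gcongr

lemma half_prob (n : ℕ) :
    (1 / 2 : ℝ≥0∞) ≤ ((Measure.pi fun _ : Fin n => gaussianReal 0 1).prod
      (Measure.pi fun _ : Fin n => gaussianReal 0 1)) {q | ‖q.2‖ ≤ ‖q.1‖} := by
  set P := Measure.pi fun _ : Fin n => gaussianReal 0 1 with hP
  have hsw : (P.prod P) {q | ‖q.1‖ ≤ ‖q.2‖} = (P.prod P) {q | ‖q.2‖ ≤ ‖q.1‖} :=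
    (Measure.measurePreserving_swap (μ := P) (ν := P)).measure_preimage
      (s := {q | ‖q.2‖ ≤ ‖q.1‖})
      (measurableSet_le (by fun_prop) (by fun_prop)).nullMeasurableSet
  have hu : (1 : ℝ≥0∞) ≤ (P.prod P) {q | ‖q.2‖ ≤ ‖q.1‖} + (P.prod P) {q | ‖q.2‖ ≤ ‖q.1‖} := by
    nth_rewrite 1 [← hsw]
    refine le_trans ?_ (measure_union_le _ _)
    have : {q : (Fin n → ℝ) × (Fin n → ℝ) | ‖q.1‖ ≤ ‖q.2‖} ∪ {q | ‖q.2‖ ≤ ‖q.1‖} = univ := by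
      ext q; simp [le_total]
    rw [this, measure_univ]
  rw [← two_mul] at hu
  rw [one_div]
  exact ENNReal.inv_le_iff_le_mul (by simp) (by simp) |>.mpr hu

lemma gauss_big (s : ℝ) (hs : 1 ≤ s) :
    ENNReal.ofReal ((√(2 * π))⁻¹ * exp (-(9 / 2) * s ^ 2)) ≤
      gaussianReal 0 1 {t : ℝ | s + 1 ≤ |t|} := by
  have hsub : Icc (s + 1) (s + 2) ⊆ {t : ℝ | s + 1 ≤ |t|} := fun t ht => ht.1.trans (le_abs_self t)
  refine le_trans ?_ (measure_mono hsub)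
  rw [gaussianReal_apply _ one_ne_zero]
  calc _ = ∫⁻ x in Icc (s+1) (s+2), ENNReal.ofReal ((√(2 * π))⁻¹ * exp (-(9 / 2) * s ^ 2)) := by
        rw [setLIntegral_const, Real.volume_Icc]
        norm_num
    _ ≤ _ := by
        refine setLIntegral_mono (measurable_gaussianPDF 0 1) fun x hx => ?_
        rw [gaussianPDF]
        apply ENNReal.ofReal_le_ofReal
        simp only [gaussianPDFReal, NNReal.coe_one, mul_one]
        refine mul_le_mul_of_nonneg_left ?_ (by positivity)
        apply Real.exp_le_exp.mpr
        have h1 : x ≤ 3 * s := by linarith [hx.2]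
        have h0 : 0 ≤ x := by linarith [hx.1]
        nlinarith

lemma lower_prob (n : ℕ) (s : ℝ) :
    gaussianReal 0 1 {t : ℝ | s + 1 ≤ |t|} * (gaussianReal 0 1 {t : ℝ | |t| ≤ 1} * (1 / 2)) ≤
      ((gaussPair n).prod (gaussPair n)) {q | s ≤ |fPerturb q.1 - fPerturb q.2|} := by
  set P := Measure.pi fun _ : Fin n => gaussianReal 0 1 with hP
  set S := {t : ℝ | s + 1 ≤ |t|} with hS
  set T := {t : ℝ | |t| ≤ 1} with hT
  have hSm : MeasurableSet S := measurableSet_le (by fun_prop) (by fun_prop)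
  have hTm : MeasurableSet T := measurableSet_le (by fun_prop) (by fun_prop)
  have hm := fPerturb_meas n
  have hDm : MeasurableSet {q : (ℝ × (Fin n → ℝ)) × (ℝ × (Fin n → ℝ)) |
    s ≤ |fPerturb q.1 - fPerturb q.2|} := measurableSet_le (by fun_prop) (by fun_prop)
  have hLm : MeasurableSet {q : (Fin n → ℝ) × (Fin n → ℝ) | ‖q.2‖ ≤ ‖q.1‖} :=
    measurableSet_le (by fun_prop) (by fun_prop)
  have hLm' : Measurable fun x : Fin n → ℝ => P {y | ‖y‖ ≤ ‖x‖} := measurable_measure_prodMk_left hLm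
  rw [Measure.prod_apply hDm]
  have hb : ∀ p : ℝ × (Fin n → ℝ), S.indicator 1 p.1 *
      (gaussianReal 0 1 T * P {y | ‖y‖ ≤ ‖p.2‖}) ≤
      gaussPair n (Prod.mk p ⁻¹' {q : (ℝ × (Fin n → ℝ)) × (ℝ × (Fin n → ℝ)) |
        s ≤ |fPerturb q.1 - fPerturb q.2|}) := by
    intro p
    by_cases hp : p.1 ∈ S
    · rw [indicator_of_mem hp, Pi.one_apply, one_mul, ← Measure.prod_prod]
      apply measure_mono
      rintro ⟨u, y⟩ ⟨hu, hy⟩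
      have hu : |u| ≤ 1 := hu
      have hy : ‖y‖ ≤ ‖p.2‖ := hy
      have hp : s + 1 ≤ |p.1| := hp
      change s ≤ |(|p.1| + ‖p.2‖) - (|u| + ‖y‖)|
      refine le_trans ?_ (le_abs_self _)
      linarith
    · rw [indicator_of_notMem hp, zero_mul]; exact zero_le
  refine le_trans ?_ (lintegral_mono hb)
  unfold gaussPair
  rw [lintegral_prod_mul (f := S.indicator 1)
    (g := fun x => gaussianReal 0 1 T * P {y | ‖y‖ ≤ ‖x‖})
    (measurable_one.indicator hSm).aemeasurable (hLm'.const_mul _).aemeasurable,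
    lintegral_indicator_one hSm, lintegral_const_mul _ hLm']
  gcongr
  refine (half_prob n).trans_eq ?_
  rw [Measure.prod_apply hLm]
  rfl

/-- There are absolute constants `c, C > 0` such that for all
sufficiently large `n` and all `r ≥ 1`:
`c√r ≤ (E|f(g₁,Z₁) − f(g₂,Z₂)|^r)^{1/r} ≤ C√r`, where `(g₁,Z₁)` and `(g₂,Z₂)` are
independent standard Gaussian vectors on `ℝ^{n+1}`. -/
theorem moments_of_f_difference :
    ∃ c C : ℝ, 0 < c ∧ 0 < C ∧
      ∃ n₀ : ℕ, ∀ n : ℕ, n₀ ≤ n → ∀ r : ℝ, 1 ≤ r →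
        c * Real.sqrt r ≤
          (∫ q, |fPerturb q.1 - fPerturb q.2| ^ r ∂((gaussPair n).prod (gaussPair n)))
            ^ (1 / r) ∧
        (∫ q, |fPerturb q.1 - fPerturb q.2| ^ r ∂((gaussPair n).prod (gaussPair n)))
            ^ (1 / r) ≤ C * Real.sqrt r := by
  set T := {t : ℝ | |t| ≤ 1} with hT
  have hT0 : gaussianReal 0 1 T ≠ 0 := by
    intro h0
    have h1 := gaussianReal_absolutelyContinuous' 0 (one_ne_zero (α := NNReal)) h0
    have h2 : T = Icc (-1) 1 := by ext t; simp [hT, abs_le]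
    rw [h2, Real.volume_Icc] at h1
    norm_num at h1
  set τ := (gaussianReal 0 1 T).toReal with hτ
  have hτ0 : 0 < τ := ENNReal.toReal_pos hT0 (measure_ne_top _ _)
  have hτe : gaussianReal 0 1 T = ENNReal.ofReal τ := (ENNReal.ofReal_toReal (measure_ne_top _ _)).symm
  set k := (√(2 * π))⁻¹ * (τ * (1 / 2)) with hk
  have hk0 : 0 < k := by positivity
  have hk1 : k ≤ 1 := by
    have h1 : τ ≤ 1 := by
      rw [hτ]; exact ENNReal.toReal_le_of_le_ofReal zero_le_one (by simpa using prob_le_one)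
    have h2 : (√(2 * π))⁻¹ ≤ 1 := by
      apply inv_le_one_of_one_le₀
      rw [Real.one_le_sqrt]
      linarith [Real.pi_gt_three]
    have : 0 ≤ (√(2 * π))⁻¹ := by positivity
    calc k ≤ 1 * (1 * (1/2)) := by rw [hk]; gcongr
      _ ≤ 1 := by norm_num
  refine ⟨k * exp (-(9/2)), 64 * exp 1, by positivity, by positivity, 0, fun n _ r hr => ?_⟩
  have hr0 : 0 < r := by linarith
  have hsr : 1 ≤ √r := Real.one_le_sqrt.mpr hr
  have hm : Measurable fun q : (ℝ × (Fin n → ℝ)) × (ℝ × (Fin n → ℝ)) =>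
      |fPerturb q.1 - fPerturb q.2| := by
    have := fPerturb_meas n
    fun_prop
  have hmr : Measurable fun q : (ℝ × (Fin n → ℝ)) × (ℝ × (Fin n → ℝ)) =>
      |fPerturb q.1 - fPerturb q.2| ^ r := hm.pow_const r
  have h_integral := integral_eq_lintegral_of_nonneg_ae (μ := (gaussPair n).prod (gaussPair n))
    (ae_of_all _ fun q => Real.rpow_nonneg (abs_nonneg (fPerturb q.1 - fPerturb q.2)) r)
    hmr.aestronglyMeasurable
  rw [h_integral]
  have hup := upper_lint n r hr
  set I := ∫⁻ q, ENNReal.ofReal (|fPerturb q.1 - fPerturb q.2| ^ r)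
    ∂((gaussPair n).prod (gaussPair n)) with hI
  have hItop : I ≠ ∞ := ne_top_of_le_ne_top ENNReal.ofReal_ne_top hup
  constructor
  · have hlow : ENNReal.ofReal ((√r) ^ r * (k * exp (-(9/2) * r))) ≤ I := by
      have hmk := mul_meas_ge_le_lintegral (μ := (gaussPair n).prod (gaussPair n))
        hmr.ennreal_ofReal (ENNReal.ofReal ((√r) ^ r))
      refine le_trans ?_ hmk
      rw [ENNReal.ofReal_mul (by positivity)]
      gcongr
      have hsub : {q : (ℝ × (Fin n → ℝ)) × (ℝ × (Fin n → ℝ)) |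
          √r ≤ |fPerturb q.1 - fPerturb q.2|} ⊆
          {q | ENNReal.ofReal ((√r) ^ r) ≤ ENNReal.ofReal (|fPerturb q.1 - fPerturb q.2| ^ r)} := by
        intro q hq
        exact ENNReal.ofReal_le_ofReal (Real.rpow_le_rpow (by positivity) hq hr0.le)
      refine le_trans ?_ (measure_mono hsub)
      refine le_trans ?_ (lower_prob n (√r))
      have hg := gauss_big (√r) hsr
      rw [Real.sq_sqrt hr0.le] at hg
      have hhalf : (1 / 2 : ℝ≥0∞) = ENNReal.ofReal (1 / 2) := by
        rw [ENNReal.ofReal_div_of_pos (by norm_num)]; simp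
      calc _ = ENNReal.ofReal ((√(2 * π))⁻¹ * exp (-(9 / 2) * r)) *
            (ENNReal.ofReal τ * ENNReal.ofReal (1/2)) := by
            rw [← ENNReal.ofReal_mul (by positivity), ← ENNReal.ofReal_mul (by positivity)]
            congr 1
            rw [hk]; ring
        _ ≤ _ := by
            rw [← hτe, ← hhalf]
            gcongr
    have hlow' : (√r) ^ r * (k * exp (-(9/2) * r)) ≤ I.toReal :=
      (ENNReal.ofReal_le_iff_le_toReal hItop).mp hlow
    have hkr : k ^ r ≤ k := by
      simpa using Real.rpow_le_rpow_of_exponent_ge hk0 hk1 hr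
    have h3 : (k * exp (-(9/2)) * √r) ^ r ≤ I.toReal := by
      refine le_trans ?_ hlow'
      rw [Real.mul_rpow (by positivity) (by positivity), Real.mul_rpow (by positivity) (by positivity),
        ← Real.exp_mul, mul_comm ((√r) ^ r)]
      gcongr
    calc k * exp (-(9/2)) * √r = ((k * exp (-(9/2)) * √r) ^ r) ^ (1 / r) := by
          rw [← Real.rpow_mul (by positivity), mul_one_div_cancel hr0.ne', Real.rpow_one]
      _ ≤ _ := Real.rpow_le_rpow (by positivity) h3 (by positivity)
  · have h3 : I.toReal ≤ (64 * exp 1 * √r) ^ r :=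
      ENNReal.toReal_le_of_le_ofReal (by positivity) hup
    calc _ ≤ ((64 * exp 1 * √r) ^ r) ^ (1 / r) :=
          Real.rpow_le_rpow ENNReal.toReal_nonneg h3 (by positivity)
      _ = _ := by
          rw [← Real.rpow_mul (by positivity), mul_one_div_cancel hr0.ne', Real.rpow_one]
end

section
/- There exists an absolute constant C > 0 such that for every symmetric convex body K in ℝⁿ: ϑ(γ_n, K) ≤ C√n, where ϑ(γ_n, K) = m·f_K(m), f_K is the density of the random variable ‖Z‖_K with Z ~ γ_n, and m is a median of ‖Z‖_K. -/
open MeasureTheory ProbabilityTheory Real Set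

/-- The Gaussian product measure on `Fin n → ℝ`. -/
noncomputable def gpi (n : ℕ) : Measure (Fin n → ℝ) :=
  Measure.pi fun _ : Fin n => gaussianReal 0 1

/-- Its density. -/
noncomputable def gdens (n : ℕ) (x : Fin n → ℝ) : ℝ := ∏ i, gaussianPDFReal 0 1 (x i)

instance gpi_prob (n : ℕ) : IsProbabilityMeasure (gpi n) := by
  unfold gpi; infer_instance

lemma gdens_nonneg (n : ℕ) (x : Fin n → ℝ) : 0 ≤ gdens n x :=
  Finset.prod_nonneg fun _ _ => gaussianPDFReal_nonneg _ _ _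

lemma gdens_meas (n : ℕ) : Measurable (gdens n) := by
  unfold gdens
  exact Finset.measurable_prod _ fun i _ =>
    (measurable_gaussianPDFReal 0 1).comp (measurable_pi_apply i)

lemma gdens_integrable (n : ℕ) : Integrable (gdens n) := by
  unfold gdens
  exact Integrable.fintype_prod (f := fun _ : Fin n => gaussianPDFReal 0 1)
    fun _ => integrable_gaussianPDFReal 0 1

lemma gpi_eq (n : ℕ) : gpi n = volume.withDensity (fun x => ENNReal.ofReal (gdens n x)) := by
  unfold gpi
  refine Measure.pi_eq fun s hs => ?_
  rw [withDensity_apply _ (MeasurableSet.univ_pi hs),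
    ← ofReal_integral_eq_lintegral_ofReal (gdens_integrable n).integrableOn
      (Filter.Eventually.of_forall (gdens_nonneg n)), volume_pi, Measure.restrict_pi_pi]
  unfold gdens
  rw [integral_fintype_prod_eq_prod (f := fun _ : Fin n => gaussianPDFReal 0 1),
    ENNReal.ofReal_prod_of_nonneg
      (fun i _ => integral_nonneg (gaussianPDFReal_nonneg 0 1))]
  refine Finset.prod_congr rfl fun i _ => ?_
  rw [gaussianReal_apply_eq_integral _ one_ne_zero]

lemma gpi_setIntegral (n : ℕ) (A : Set (Fin n → ℝ)) (hA : MeasurableSet A)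
    (w : (Fin n → ℝ) → ℝ) :
    ∫ x in A, w x ∂(gpi n) = ∫ x in A, gdens n x * w x := by
  rw [gpi_eq, setIntegral_withDensity_eq_setIntegral_toReal_smul
    (gdens_meas n).ennreal_ofReal (by simp) _ hA]
  simp [ENNReal.toReal_ofReal (gdens_nonneg n _)]

lemma gpi_integrable (n : ℕ) (w : (Fin n → ℝ) → ℝ) (hw : Integrable w (gpi n)) :
    Integrable (fun x => gdens n x * w x) := by
  rw [gpi_eq, integrable_withDensity_iff_integrable_smul'
    (gdens_meas n).ennreal_ofReal (by simp)] at hw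
  simpa [ENNReal.toReal_ofReal (gdens_nonneg n _)] using hw

lemma gpi_scale (n : ℕ) (A : Set (Fin n → ℝ)) (hA : MeasurableSet A) {s : ℝ} (hs : 0 < s) :
    (gpi n).real {x | s⁻¹ • x ∈ A} = ∫ y in A, s ^ n * gdens n (s • y) := by
  have hB : MeasurableSet {x : Fin n → ℝ | s⁻¹ • x ∈ A} :=
    (measurable_const_smul (s⁻¹)) hA
  have h1 : (gpi n).real {x | s⁻¹ • x ∈ A} = ∫ x in {x | s⁻¹ • x ∈ A}, gdens n x := by
    have := gpi_setIntegral n _ hB (fun _ => 1)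
    simpa using this
  have h2 := Measure.integral_comp_smul (volume : Measure (Fin n → ℝ))
    (A.indicator fun y => gdens n (s • y)) s⁻¹
  rw [integral_indicator hA] at h2
  rw [h1, ← integral_indicator hB, integral_const_mul]
  have h3 : ({x | s⁻¹ • x ∈ A}.indicator fun x => gdens n x)
      = fun x => A.indicator (fun y => gdens n (s • y)) (s⁻¹ • x) := by
    ext x
    by_cases hx : s⁻¹ • x ∈ A
    · simp [Set.indicator, hx, smul_smul, hs.ne']
    · simp [Set.indicator, hx]
  rw [h3, h2]
  simp [abs_of_pos hs]

lemma gdens_scale (n : ℕ) (y : Fin n → ℝ) {s : ℝ} (hs : 0 < s) :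
    gdens n y * (1 + (n * Real.log s - (s ^ 2 - 1) / 2 * ∑ i, y i ^ 2))
      ≤ s ^ n * gdens n (s • y) := by
  have h : s ^ n * gdens n (s • y)
      = gdens n y * Real.exp (n * Real.log s - (s ^ 2 - 1) / 2 * ∑ i, y i ^ 2) := by
    have e : s ^ n = ∏ _i : Fin n, s := by simp
    have e2 : Real.exp (n * Real.log s - (s ^ 2 - 1) / 2 * ∑ i, y i ^ 2)
        = ∏ i : Fin n, (s * Real.exp (- ((s ^ 2 - 1) / 2 * y i ^ 2))) := by
      rw [Finset.prod_mul_distrib, ← e, ← Real.exp_sum, sub_eq_add_neg, Real.exp_add,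
        Real.exp_nat_mul, Real.exp_log hs, Finset.sum_neg_distrib, Finset.mul_sum]
    rw [e, e2, gdens, gdens, ← Finset.prod_mul_distrib, ← Finset.prod_mul_distrib]
    refine Finset.prod_congr rfl fun i _ => ?_
    simp only [gaussianPDFReal, Pi.smul_apply, smul_eq_mul]
    have : Real.exp (-(s * y i - 0) ^ 2 / (2 * ((1 : NNReal) : ℝ)))
      = Real.exp (-(y i - 0) ^ 2 / (2 * ((1 : NNReal) : ℝ)))
        * Real.exp (- ((s ^ 2 - 1) / 2 * y i ^ 2)) := by
      rw [← Real.exp_add]; congr 1; push_cast; ring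
    rw [this]; ring
  rw [h]
  refine mul_le_mul_of_nonneg_left ?_ (gdens_nonneg n y)
  linarith [Real.add_one_le_exp (n * Real.log s - (s ^ 2 - 1) / 2 * ∑ i, y i ^ 2)]

lemma memLp_sq : MemLp (fun x : ℝ => x ^ 2) 2 (gaussianReal 0 1) := by
  have h := memLp_id_gaussianReal' (μ := 0) (v := 1) 4 (by simp)
  rw [memLp_two_iff_integrable_sq (by fun_prop)]
  have := h.integrable_norm_pow (p := 4) (by norm_num)
  refine this.congr (Filter.Eventually.of_forall fun x => ?_)
  simp only [id, Real.norm_eq_abs]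
  rw [Even.pow_abs (by decide)]; ring

lemma memLp_sumsq (n : ℕ) : MemLp (fun x : Fin n → ℝ => ∑ i, x i ^ 2) 2 (gpi n) := by
  refine memLp_finsetSum _ fun i _ => ?_
  exact memLp_sq.comp_measurePreserving (measurePreserving_eval (fun _ : Fin n => gaussianReal 0 1) i)

lemma integral_sumsq (n : ℕ) : ∫ x, ∑ i, x i ^ 2 ∂(gpi n) = n := by
  have h1 : ∫ x, x ^ 2 ∂(gaussianReal 0 1) = 1 := by
    have h := variance_fun_id_gaussianReal (μ := 0) (v := 1)
    rw [variance_eq_integral (by fun_prop)] at h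
    simpa using h
  rw [integral_finsetSum]
  · have : ∀ i : Fin n, ∫ x, x i ^ 2 ∂(gpi n) = 1 := fun i => by
      rw [← h1]
      exact integral_comp_eval (μ := fun _ : Fin n => gaussianReal 0 1) (f := fun x : ℝ => x ^ 2)
        (by fun_prop)
    simp [this]
  · intro i _
    exact (memLp_sq.comp_measurePreserving
      (measurePreserving_eval (fun _ : Fin n => gaussianReal 0 1) i)).integrable one_le_two

lemma setIntegral_bound (n : ℕ) (A : Set (Fin n → ℝ)) :
    ∫ x in A, ((n : ℝ) - ∑ i, x i ^ 2) ∂(gpi n)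
      ≤ Real.sqrt (Var[fun x : ℝ => x ^ 2; gaussianReal 0 1]) * Real.sqrt n := by
  set V := Var[fun x : ℝ => x ^ 2; gaussianReal 0 1]
  set Y : (Fin n → ℝ) → ℝ := fun x => ∑ i, x i ^ 2 with hY
  have hYL := memLp_sumsq n
  have hvar : ∫ x, (Y x - n) ^ 2 ∂(gpi n) = n * V := by
    have h := variance_sum_pi (μ := fun _ : Fin n => gaussianReal 0 1)
      (X := fun _ x => x ^ 2) fun _ => memLp_sq
    have e : (∑ i : Fin n, fun ω : Fin n → ℝ => ω i ^ 2) = Y := by ext x; simp [hY]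
    rw [e] at h
    change Var[Y; gpi n] = _ at h
    rw [variance_eq_integral hYL.aestronglyMeasurable.aemeasurable, integral_sumsq] at h
    simpa using h
  have hsub : MemLp (fun x => Y x - n) 2 (gpi n) := hYL.sub (memLp_const _)
  have habs : MemLp (fun x => |Y x - n|) 2 (gpi n) := hsub.abs
  have hle : ∫ x in A, ((n : ℝ) - Y x) ∂(gpi n) ≤ ∫ x, |Y x - n| ∂(gpi n) := by
    have hi : Integrable (fun x => |Y x - n|) (gpi n) := habs.integrable one_le_two
    calc _ ≤ ∫ x in A, |Y x - n| ∂(gpi n) := by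
          refine integral_mono ?_ hi.integrableOn fun x => ?_
          · have := (hsub.integrable one_le_two).neg.integrableOn (s := A)
            refine this.congr (Filter.Eventually.of_forall fun x => ?_)
            simp
          · show (n : ℝ) - Y x ≤ |Y x - n|
            rw [abs_sub_comm]; exact le_abs_self _
      _ ≤ _ := setIntegral_le_integral hi (Filter.Eventually.of_forall fun x => abs_nonneg _)
  refine hle.trans ?_
  have hv := variance_nonneg (fun x => |Y x - n|) (gpi n)
  rw [variance_eq_sub habs] at hv
  have e : (gpi n)[(fun x => |Y x - n|) ^ 2] = n * V := by
    rw [← hvar]; congr 1; ext x; simp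
  rw [e] at hv
  rw [← Real.sqrt_mul (variance_nonneg _ _)]
  apply Real.le_sqrt_of_sq_le
  linarith

lemma deriv_bound (n : ℕ) (h : (Fin n → ℝ) → ℝ) (hm : Measurable h)
    (hs : ∀ s : ℝ, 0 < s → ∀ x, h (s • x) = s * h x) (m d : ℝ) (hm0 : 0 < m)
    (hd : HasDerivAt (fun t => (gpi n).real {x | h x ≤ t}) d m) :
    m * d ≤ Real.sqrt (Var[fun x : ℝ => x ^ 2; gaussianReal 0 1]) * Real.sqrt n := by
  set A := {x | h x ≤ m} with hAdef
  have hA : MeasurableSet A := measurableSet_le hm measurable_const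
  refine le_trans (le_of_eq ?_) (setIntegral_bound n A)
  have hYi : Integrable (fun x : Fin n → ℝ => ∑ i, x i ^ 2) (gpi n) :=
    (memLp_sumsq n).integrable one_le_two
  set G : ℝ → ℝ := fun s => (gpi n).real {x | h x ≤ s * m} with hG
  have hG' : HasDerivAt G (d * m) 1 := by
    have h1 : HasDerivAt (fun s : ℝ => s * m) m 1 := by
      simpa using (hasDerivAt_id (1 : ℝ)).mul_const m
    have := HasDerivAt.comp (x := (1 : ℝ)) (h := fun s : ℝ => s * m)
      (h₂ := fun t => (gpi n).real {x | h x ≤ t}) (h₂' := d) (by simpa using hd) h1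
    exact this
  set a := (gpi n).real A
  set b := ∫ x in A, ∑ i, x i ^ 2 ∂(gpi n) with hb
  have key : ∀ s : ℝ, 0 < s → a + (n * Real.log s * a - (s ^ 2 - 1) / 2 * b) ≤ G s := by
    intro s hs0
    have e : {x | h x ≤ s * m} = {x | s⁻¹ • x ∈ A} := by
      ext x
      simp only [hAdef, mem_ofPred_eq]
      rw [hs _ (inv_pos.2 hs0), inv_mul_le_iff₀ hs0]
    simp only [hG]
    rw [e, gpi_scale n A hA hs0]
    have hw : Integrable (fun y : Fin n → ℝ =>
        1 + (n * Real.log s - (s ^ 2 - 1) / 2 * ∑ i, y i ^ 2)) (gpi n) :=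
      (integrable_const _).add ((integrable_const _).sub (hYi.const_mul _))
    have e2 : ∫ y in A, (1 + (n * Real.log s - (s ^ 2 - 1) / 2 * ∑ i, y i ^ 2)) ∂(gpi n)
        = a + (n * Real.log s * a - (s ^ 2 - 1) / 2 * b) := by
      have hw2 : Integrable (fun y : Fin n → ℝ =>
          n * Real.log s - (s ^ 2 - 1) / 2 * ∑ i, y i ^ 2) ((gpi n).restrict A) :=
        (integrable_const _).sub (hYi.integrableOn.const_mul _)
      rw [integral_add (integrable_const _) hw2,
        integral_sub (integrable_const _) (hYi.integrableOn.const_mul _),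
        integral_const_mul ((s ^ 2 - 1) / 2) (fun y : Fin n → ℝ => ∑ i, y i ^ 2), ← hb]
      simp [a]; ring
    rw [← e2, gpi_setIntegral n A hA]
    refine setIntegral_mono (gpi_integrable n _ hw).integrableOn ?_
      fun y => gdens_scale n y hs0
    exact (((integrable_comp_smul_iff volume (gdens n) hs0.ne').2
      (gdens_integrable n)).const_mul _).integrableOn
  have hD : HasDerivAt (fun s => G s - (a + (n * Real.log s * a - (s ^ 2 - 1) / 2 * b)))
      (d * m - (n * a - b)) 1 := by
    refine hG'.sub ?_
    have h1 := (((Real.hasDerivAt_log one_ne_zero).const_mul (n : ℝ)).mul_const a).sub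
      ((((hasDerivAt_pow 2 (1 : ℝ)).sub_const 1).div_const 2).mul_const b)
    have h2 := h1.const_add a
    convert h2 using 1
    all_goals norm_num
  have hmin : IsLocalMin (fun s => G s - (a + (n * Real.log s * a - (s ^ 2 - 1) / 2 * b))) 1 := by
    filter_upwards [lt_mem_nhds (zero_lt_one' ℝ)] with s hs0
    have := key s hs0
    have h1 : G 1 = a := by simp [hG, a, hAdef]
    simp only [h1, Real.log_one]
    norm_num
    linarith
  have h0 := hmin.hasDerivAt_eq_zero hD
  have e3 : ∫ x in A, ((n : ℝ) - ∑ i, x i ^ 2) ∂(gpi n) = n * a - b := by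
    rw [integral_sub (integrable_const _) hYi.integrableOn]
    simp [a, hb]; ring
  rw [e3]; linarith

/-- There is an absolute constant `C > 0` such that for every symmetric
convex body `K ⊆ ℝⁿ`: `ϑ(γ_n, K) = m·f_K(m) ≤ C√n`, where `f_K` is the density of
`‖Z‖_K` (the gauge of `K` evaluated at `Z ~ γ_n`) and `m` is a median of `‖Z‖_K`;
the value `f_K(m)` is pinned down as the derivative of the cumulative distribution
function at `m`. -/
theorem theta_gaussian_le_sqrt :
    ∃ C : ℝ, 0 < C ∧
      ∀ (n : ℕ) (K : Set (EuclideanSpace ℝ (Fin n))),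
        IsCompact K → Convex ℝ K → K = -K → (interior K).Nonempty →
        ∀ (fK : ℝ → ℝ) (m : ℝ),
          (stdGaussian n).map (gauge K) =
            volume.withDensity (fun t => ENNReal.ofReal (fK t)) →
          HasDerivAt (fun t => ((stdGaussian n) {x | gauge K x ≤ t}).toReal) (fK m) m →
          (1 : ENNReal) / 2 ≤ (stdGaussian n) {x | gauge K x ≤ m} →
          (1 : ENNReal) / 2 ≤ (stdGaussian n) {x | m ≤ gauge K x} →
          m * fK m ≤ C * Real.sqrt n := by
  set V := Var[fun x : ℝ => x ^ 2; gaussianReal 0 1]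
  refine ⟨Real.sqrt V + 1, by positivity, ?_⟩
  intro n K hK hconv hsymm hint fK m _ hd _ _
  rcases lt_trichotomy m 0 with hm | hm | hm
  · have hz : HasDerivAt (fun t => ((stdGaussian n) {x | gauge K x ≤ t}).toReal) 0 m := by
      refine (hasDerivAt_const m (0 : ℝ)).congr_of_eventuallyEq ?_
      filter_upwards [gt_mem_nhds hm] with t ht
      have : {x | gauge K x ≤ t} = ∅ := by
        ext x
        simp only [mem_ofPred_eq, mem_empty_iff_false, iff_false, not_le]
        exact ht.trans_le (gauge_nonneg x)
      simp [this]
    rw [hd.unique hz]; simp; positivity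
  · rw [hm]; simp; positivity
  · have h0 : K ∈ nhds (0 : EuclideanSpace ℝ (Fin n)) := by
      obtain ⟨x, hx⟩ := hint
      have hxneg : -x ∈ interior K := by
        rw [hsymm, ← image_neg_eq_neg]
        have := (Homeomorph.neg (EuclideanSpace ℝ (Fin n))).image_interior K
        have h2 : -x ∈ Set.image (Homeomorph.neg (EuclideanSpace ℝ (Fin n))) (interior K) := ⟨x, hx, rfl⟩
        rw [this] at h2
        exact h2
      have := hconv.interior hx hxneg (a := 1 / 2) (b := 1 / 2) (by norm_num) (by norm_num)
        (by norm_num)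
      rw [smul_neg, add_neg_cancel] at this
      exact mem_interior_iff_mem_nhds.1 this
    have hcont := continuous_gauge hconv h0
    have hmeasE : Measurable (EuclideanSpace.equiv (Fin n) ℝ).symm :=
      (EuclideanSpace.equiv (Fin n) ℝ).symm.continuous.measurable
    have hh : Measurable fun x : Fin n → ℝ => gauge K ((EuclideanSpace.equiv (Fin n) ℝ).symm x) :=
      hcont.measurable.comp hmeasE
    have := deriv_bound n (fun x => gauge K ((EuclideanSpace.equiv (Fin n) ℝ).symm x)) hh
      (fun s hs x => by
        rw [map_smul, gauge_smul_of_nonneg hs.le, smul_eq_mul]) m (fK m) hm (by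
        convert hd using 2 with t
        rw [_root_.stdGaussian, Measure.map_apply hmeasE
          (measurableSet_le hcont.measurable measurable_const)]
        rfl)
    have h2 := Real.sqrt_nonneg (n : ℝ)
    nlinarith
end
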